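/- arXiv:2501.17192 — 10 statements merged into one kernel-verified Lean document; each statement's English description precedes it below -/
import Mathlib

section
/- Symmetrized quadratic identity for the kinetic operator: under Assumption A (detailed balance), for every measurable h : V × Σ → ℝ such that the map (v̂, v̂', u, w, u_*) ↦ η(u,u_*) β(w; u,u_*) f_H(u_*) (h(v̂,u)²/M(u) + h(v̂',w)²/M(w)) is integrable on V × V × Σ × Σ × Σ_H, one has ∫_V ∫_Σ G[h](v̂,u) · (h(v̂,u)/M(u)) du dv̂ = −(1/2) ∫_V ∫_V ∫_Σ ∫_Σ ∫_{Σ_H} η(u,u_*) β(w; u,u_*) M(u) (h(v̂,u)/M(u) − h(v̂',w)/M(w))² f_H(u_*) du_* dw du dv̂' dv̂; in particular ∫_V ∫_Σ G[h](v̂,u) · (h(v̂,u)/M(u)) du dv̂ ≤ 0. -/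
open MeasureTheory Measure

noncomputable section

/-- The unit sphere `S^{n-1}` in `ℝⁿ`. -/
abbrev Sph (n : ℕ) := Metric.sphere (0 : EuclideanSpace ℝ (Fin n)) 1

/-- The surface measure on the unit sphere. -/
noncomputable def sphMeasure (n : ℕ) : Measure (Sph n) :=
  (volume : Measure (EuclideanSpace ℝ (Fin n))).toSphere

/-- The conservative kinetic interaction operator. -/
noncomputable def Gop (n : ℕ) (S SH : Set ℝ) (η : ℝ → ℝ → ℝ) (βk : ℝ → ℝ → ℝ → ℝ)
    (fH : ℝ → ℝ) (h : Sph n → ℝ → ℝ) (v : Sph n) (u : ℝ) : ℝ :=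
  ∫ v', (∫ ustar in SH, ∫ u' in S,
      (η u' ustar * βk u u' ustar * h v' u' - η u ustar * βk u' u ustar * h v u) * fH ustar)
    ∂(sphMeasure n)

lemma iter5_aux {X1 X2 X3 X4 X5 : Type*} [MeasurableSpace X1] [MeasurableSpace X2]
    [MeasurableSpace X3] [MeasurableSpace X4] [MeasurableSpace X5]
    (m1 : Measure X1) (m2 : Measure X2) (m3 : Measure X3) (m4 : Measure X4) (m5 : Measure X5)
    [SFinite m1] [SFinite m2] [SFinite m3] [SFinite m4] [SFinite m5]
    (F : X1 × X2 × X3 × X4 × X5 → ℝ)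
    (hF : Integrable F (m1.prod (m2.prod (m3.prod (m4.prod m5))))) :
    (∫ a, ∫ b, ∫ c, ∫ d, ∫ e, F (a, b, c, d, e) ∂m5 ∂m4 ∂m3 ∂m2 ∂m1)
      = ∫ p, F p ∂(m1.prod (m2.prod (m3.prod (m4.prod m5)))) := by
  rw [integral_prod _ hF]
  refine integral_congr_ae ?_
  filter_upwards [hF.prod_right_ae] with a ha
  rw [integral_prod _ ha]
  refine integral_congr_ae ?_
  filter_upwards [ha.prod_right_ae] with b hb
  rw [integral_prod _ hb]
  refine integral_congr_ae ?_
  filter_upwards [hb.prod_right_ae] with c hc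
  rw [integral_prod _ hc]

lemma iter5_comp_aux {X1 X2 X3 X4 X5 Z : Type*} [MeasurableSpace X1] [MeasurableSpace X2]
    [MeasurableSpace X3] [MeasurableSpace X4] [MeasurableSpace X5] [MeasurableSpace Z]
    (m1 : Measure X1) (m2 : Measure X2) (m3 : Measure X3) (m4 : Measure X4) (m5 : Measure X5)
    [SFinite m1] [SFinite m2] [SFinite m3] [SFinite m4] [SFinite m5] (ρ : Measure Z)
    (F : Z → ℝ) (e : X1 × X2 × X3 × X4 × X5 → Z)
    (mp : MeasurePreserving e (m1.prod (m2.prod (m3.prod (m4.prod m5)))) ρ)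
    (me : MeasurableEmbedding e) (hF : Integrable F ρ) :
    (∫ a, ∫ b, ∫ c, ∫ d, ∫ x, F (e (a, b, c, d, x)) ∂m5 ∂m4 ∂m3 ∂m2 ∂m1) = ∫ p, F p ∂ρ :=
  (iter5_aux m1 m2 m3 m4 m5 _ ((mp.integrable_comp_emb me).mpr hF)).trans
    (mp.integral_comp me F)

lemma abs_aux {X Y : Type*} [MeasurableSpace X] [MeasurableSpace Y] (μ : Measure X)
    (ν : Measure Y) [SFinite μ] [SFinite ν] (A : X → X → Y → ℝ)
    (hAm : AEStronglyMeasurable (fun p : (X × X) × Y => A p.1.1 p.1.2 p.2) ((μ.prod μ).prod ν))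
    (hA0 : ∀ x y s, 0 ≤ A x y s) (m g : X → ℝ) (hm : Measurable m) (hg : Measurable g)
    (G : X → Prop) (hG : ∀ᵐ x ∂μ, G x) (hm0 : ∀ x, G x → 0 < m x)
    (hAi : ∀ x y, G x → G y → Integrable (A x y) ν)
    (hdb : ∀ x y, G x → G y → (∫ s, A x y s ∂ν) * m x = (∫ s, A y x s ∂ν) * m y)
    (h1 : Integrable (fun p : (X × X) × Y => A p.1.1 p.1.2 p.2 * m p.1.1 * g p.1.1 ^ 2)
      ((μ.prod μ).prod ν)) :
    Integrable (fun p : (X × X) × Y => A p.1.2 p.1.1 p.2 * m p.1.2 * g p.1.2 * g p.1.1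
        - A p.1.1 p.1.2 p.2 * m p.1.1 * g p.1.1 ^ 2) ((μ.prod μ).prod ν) ∧
    Integrable (fun p : (X × X) × Y => A p.1.1 p.1.2 p.2 * m p.1.1 * (g p.1.1 - g p.1.2) ^ 2)
        ((μ.prod μ).prod ν) ∧
    (∫ p : (X × X) × Y, (A p.1.2 p.1.1 p.2 * m p.1.2 * g p.1.2 * g p.1.1
        - A p.1.1 p.1.2 p.2 * m p.1.1 * g p.1.1 ^ 2) ∂((μ.prod μ).prod ν)) =
      -(1 / 2) * ∫ p : (X × X) × Y, A p.1.1 p.1.2 p.2 * m p.1.1 * (g p.1.1 - g p.1.2) ^ 2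
        ∂((μ.prod μ).prod ν) ∧
    0 ≤ ∫ p : (X × X) × Y, A p.1.1 p.1.2 p.2 * m p.1.1 * (g p.1.1 - g p.1.2) ^ 2
        ∂((μ.prod μ).prod ν) := by
  have hsw : MeasurePreserving (fun p : (X × X) × Y => ((p.1.2, p.1.1), p.2))
      ((μ.prod μ).prod ν) ((μ.prod μ).prod ν) :=
    (measurePreserving_swap (μ := μ) (ν := μ)).prod (MeasurePreserving.id ν)
  have hswe : MeasurableEmbedding (fun p : (X × X) × Y => ((p.1.2, p.1.1), p.2)) :=
    (MeasurableEquiv.prodCongr (MeasurableEquiv.prodComm (α := X) (β := X))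
      (MeasurableEquiv.refl Y)).measurableEmbedding
  have hGG : ∀ᵐ q ∂(μ.prod μ), G q.1 ∧ G q.2 := by
    have a1 := (quasiMeasurePreserving_fst (μ := μ) (ν := μ)).ae hG
    have a2 := (quasiMeasurePreserving_snd (μ := μ) (ν := μ)).ae hG
    filter_upwards [a1, a2] with q h1 h2 using ⟨h1, h2⟩
  have hGGY : ∀ᵐ p ∂((μ.prod μ).prod ν), G p.1.1 ∧ G p.1.2 :=
    (quasiMeasurePreserving_fst (μ := μ.prod μ) (ν := ν)).ae hGG
  have hAm' : AEStronglyMeasurable (fun p : (X × X) × Y => A p.1.2 p.1.1 p.2)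
      ((μ.prod μ).prod ν) := hAm.comp_measurePreserving hsw
  have mg1 : Measurable fun p : (X × X) × Y => g p.1.1 := by fun_prop
  have mg2 : Measurable fun p : (X × X) × Y => g p.1.2 := by fun_prop
  have mm1 : Measurable fun p : (X × X) × Y => m p.1.1 := by fun_prop
  have mm2 : Measurable fun p : (X × X) × Y => m p.1.2 := by fun_prop
  have hQm : AEStronglyMeasurable
      (fun p : (X × X) × Y => A p.1.2 p.1.1 p.2 * m p.1.2 * g p.1.1 ^ 2)
      ((μ.prod μ).prod ν) :=
    (hAm'.mul mm2.aestronglyMeasurable).mul (mg1.pow_const 2).aestronglyMeasurable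
  have hinner : ∀ᵐ q ∂(μ.prod μ), (∫ s, A q.2 q.1 s * m q.2 * g q.1 ^ 2 ∂ν)
      = ∫ s, A q.1 q.2 s * m q.1 * g q.1 ^ 2 ∂ν := by
    filter_upwards [hGG] with q hq
    simp only [integral_mul_const]
    rw [hdb q.1 q.2 hq.1 hq.2]
  have hQ : Integrable (fun p : (X × X) × Y => A p.1.2 p.1.1 p.2 * m p.1.2 * g p.1.1 ^ 2)
      ((μ.prod μ).prod ν) := by
    rw [integrable_prod_iff hQm]
    constructor
    · filter_upwards [hGG] with q hq
      exact ((hAi _ _ hq.2 hq.1).mul_const _).mul_const _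
    · refine h1.integral_prod_left.congr ?_
      filter_upwards [hGG, hinner] with q hq hi
      rw [← hi]
      refine integral_congr_ae (Filter.Eventually.of_forall fun s => ?_)
      simp only
      rw [Real.norm_of_nonneg]
      have := hA0 q.2 q.1 s
      have := (hm0 _ hq.2).le
      positivity
  have hQI : (∫ p : (X × X) × Y, A p.1.2 p.1.1 p.2 * m p.1.2 * g p.1.1 ^ 2
      ∂((μ.prod μ).prod ν)) =
      ∫ p : (X × X) × Y, A p.1.1 p.1.2 p.2 * m p.1.1 * g p.1.1 ^ 2 ∂((μ.prod μ).prod ν) := by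
    rw [integral_prod _ hQ, integral_prod _ h1]
    exact integral_congr_ae hinner
  have hP2 : Integrable (fun p : (X × X) × Y => A p.1.1 p.1.2 p.2 * m p.1.1 * g p.1.2 ^ 2)
      ((μ.prod μ).prod ν) := (hsw.integrable_comp_emb hswe).mpr hQ
  have hP2I : (∫ p : (X × X) × Y, A p.1.1 p.1.2 p.2 * m p.1.1 * g p.1.2 ^ 2
      ∂((μ.prod μ).prod ν)) =
      ∫ p : (X × X) × Y, A p.1.1 p.1.2 p.2 * m p.1.1 * g p.1.1 ^ 2 ∂((μ.prod μ).prod ν) := by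
    rw [← hQI]
    exact hsw.integral_comp hswe
      (fun p : (X × X) × Y => A p.1.2 p.1.1 p.2 * m p.1.2 * g p.1.1 ^ 2)
  have hP3 : Integrable
      (fun p : (X × X) × Y => A p.1.1 p.1.2 p.2 * m p.1.1 * g p.1.1 * g p.1.2)
      ((μ.prod μ).prod ν) := by
    refine (h1.add hP2).mono' (((hAm.mul mm1.aestronglyMeasurable).mul
      mg1.aestronglyMeasurable).mul mg2.aestronglyMeasurable) ?_
    filter_upwards [hGGY] with p hp
    have a1 := mul_nonneg (hA0 p.1.1 p.1.2 p.2) (hm0 _ hp.1).le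
    simp only [Pi.add_apply, Real.norm_eq_abs]
    rw [abs_le]
    constructor <;> nlinarith [mul_nonneg a1 (sq_nonneg (g p.1.1 + g p.1.2)),
      mul_nonneg a1 (sq_nonneg (g p.1.1 - g p.1.2)), mul_nonneg a1 (sq_nonneg (g p.1.1)),
      mul_nonneg a1 (sq_nonneg (g p.1.2))]
  have hP3' : Integrable
      (fun p : (X × X) × Y => A p.1.2 p.1.1 p.2 * m p.1.2 * g p.1.2 * g p.1.1)
      ((μ.prod μ).prod ν) := (hsw.integrable_comp_emb hswe).mpr hP3
  have hP3I : (∫ p : (X × X) × Y, A p.1.2 p.1.1 p.2 * m p.1.2 * g p.1.2 * g p.1.1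
      ∂((μ.prod μ).prod ν)) =
      ∫ p : (X × X) × Y, A p.1.1 p.1.2 p.2 * m p.1.1 * g p.1.1 * g p.1.2
        ∂((μ.prod μ).prod ν) :=
    hsw.integral_comp hswe
      (fun p : (X × X) × Y => A p.1.1 p.1.2 p.2 * m p.1.1 * g p.1.1 * g p.1.2)
  have hR : (fun p : (X × X) × Y => A p.1.1 p.1.2 p.2 * m p.1.1 * (g p.1.1 - g p.1.2) ^ 2)
      = fun p => (A p.1.1 p.1.2 p.2 * m p.1.1 * g p.1.1 ^ 2
          + A p.1.1 p.1.2 p.2 * m p.1.1 * g p.1.2 ^ 2)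
        - 2 * (A p.1.1 p.1.2 p.2 * m p.1.1 * g p.1.1 * g p.1.2) := by
    funext p; ring
  have h12 : Integrable (fun p : (X × X) × Y => A p.1.1 p.1.2 p.2 * m p.1.1 * g p.1.1 ^ 2
          + A p.1.1 p.1.2 p.2 * m p.1.1 * g p.1.2 ^ 2) ((μ.prod μ).prod ν) := h1.add hP2
  refine ⟨hP3'.sub h1, ?_, ?_, ?_⟩
  · rw [hR]
    exact (h1.add hP2).sub (hP3.const_mul 2)
  · rw [hR, integral_sub hP3' h1, integral_sub (h12) (hP3.const_mul 2),
      integral_add h1 hP2, integral_const_mul, hP2I, hP3I]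
    ring
  · refine integral_nonneg_of_ae ?_
    filter_upwards [hGGY] with p hp
    exact mul_nonneg (mul_nonneg (hA0 _ _ _) (hm0 _ hp.1).le) (sq_nonneg _)

lemma mp1_aux {V U H : Type*} [MeasurableSpace V] [MeasurableSpace U] [MeasurableSpace H]
    (a : Measure V) (b : Measure U) (c : Measure H) [SFinite a] [SFinite b] [SFinite c] :
    MeasurePreserving (fun p : V × U × V × H × U => (((p.1, p.2.1), (p.2.2.1, p.2.2.2.2)), p.2.2.2.1))
      (a.prod (b.prod (a.prod (c.prod b)))) (((a.prod b).prod (a.prod b)).prod c) := by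
  have e1 := (measurePreserving_prodAssoc a b (a.prod (c.prod b))).symm
  have e2 : MeasurePreserving (fun p : V × H × U => ((p.1, p.2.2), p.2.1))
      (a.prod (c.prod b)) ((a.prod b).prod c) :=
    (measurePreserving_prodAssoc a b c).symm.comp
      ((MeasurePreserving.id a).prod (measurePreserving_swap (μ := c) (ν := b)))
  have e3 := (measurePreserving_prodAssoc (a.prod b) (a.prod b) c).symm
  exact e3.comp (((MeasurePreserving.id (a.prod b)).prod e2).comp e1)

lemma mp2_aux {V U H : Type*} [MeasurableSpace V] [MeasurableSpace U] [MeasurableSpace H]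
    (a : Measure V) (b : Measure U) (c : Measure H) [SFinite a] [SFinite b] [SFinite c] :
    MeasurePreserving (fun p : V × V × U × U × H => (((p.1, p.2.2.1), (p.2.1, p.2.2.2.1)), p.2.2.2.2))
      (a.prod (a.prod (b.prod (b.prod c)))) (((a.prod b).prod (a.prod b)).prod c) := by
  have e0 : MeasurePreserving (fun p : V × U × U × H => (p.2.1, p.1, p.2.2))
      (a.prod (b.prod (b.prod c))) (b.prod (a.prod (b.prod c))) :=
    (measurePreserving_prodAssoc b a (b.prod c)).comp
      (((measurePreserving_swap (μ := a) (ν := b)).prod (MeasurePreserving.id (b.prod c))).comp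
        (measurePreserving_prodAssoc a b (b.prod c)).symm)
  have e1 := (measurePreserving_prodAssoc a b (a.prod (b.prod c))).symm
  have e2 := (measurePreserving_prodAssoc a b c).symm
  have e3 := (measurePreserving_prodAssoc (a.prod b) (a.prod b) c).symm
  exact e3.comp (((MeasurePreserving.id (a.prod b)).prod e2).comp
    (e1.comp ((MeasurePreserving.id a).prod e0)))

lemma sph_fin_aux (n : ℕ) : IsFiniteMeasure (sphMeasure n) := by
  unfold sphMeasure; infer_instance


/-- Symmetrized quadratic identity for the kinetic operator, under Assumption A
(detailed balance): the weighted quadratic form of `G` equals minus half of a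
symmetrized nonnegative expression; in particular it is nonpositive. -/
theorem stmt1 (n : ℕ) (hn : 1 ≤ n) (S SH : Set ℝ)
    (hS : MeasurableSet S) (hSH : MeasurableSet SH)
    (η : ℝ → ℝ → ℝ) (hηmeas : Measurable (Function.uncurry η))
    (hηnn : ∀ u ustar, 0 ≤ η u ustar)
    (βk : ℝ → ℝ → ℝ → ℝ) (hβmeas : Measurable fun p : ℝ × ℝ × ℝ => βk p.1 p.2.1 p.2.2)
    (hβnn : ∀ u u' ustar, 0 ≤ βk u u' ustar)
    (fH : ℝ → ℝ) (hfHnn : ∀ ustar, 0 ≤ fH ustar) (hfHint : IntegrableOn fH SH)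
    -- Assumption A
    (M : ℝ → ℝ) (hMmeas : Measurable M) (hMpos : ∀ u ∈ S, 0 < M u)
    (hMnorm : (∫ _v, (∫ u in S, M u) ∂(sphMeasure n)) = 1)
    (hMmean : (∫ u in S, u * M u) = 0)
    (hdb : ∀ w ∈ S, ∀ u ∈ S,
      (∫ ustar in SH,
        (η w ustar * βk u w ustar * M w - η u ustar * βk w u ustar * M u) * fH ustar) = 0)
    (γ : ℝ) (hγ : 0 < γ)
    (hlb : ∀ w ∈ S, ∀ u ∈ S,
      γ * M u ≤ ∫ ustar in SH, η w ustar * βk u w ustar * fH ustar)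
    -- the function h and its integrability
    (h : Sph n → ℝ → ℝ) (hhmeas : Measurable (Function.uncurry h))
    (hint : Integrable
      (fun p : Sph n × Sph n × ℝ × ℝ × ℝ =>
        η p.2.2.1 p.2.2.2.2 * βk p.2.2.2.1 p.2.2.1 p.2.2.2.2 * fH p.2.2.2.2 *
          (h p.1 p.2.2.1 ^ 2 / M p.2.2.1 + h p.2.1 p.2.2.2.1 ^ 2 / M p.2.2.2.1))
      ((sphMeasure n).prod ((sphMeasure n).prod
        ((volume.restrict S).prod ((volume.restrict S).prod (volume.restrict SH)))))) :
    (∫ v, (∫ u in S, Gop n S SH η βk fH h v u * (h v u / M u)) ∂(sphMeasure n)) =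
      -(1 / 2) *
        ∫ v, (∫ v', (∫ u in S, ∫ w in S, ∫ ustar in SH,
            η u ustar * βk w u ustar * M u *
              (h v u / M u - h v' w / M w) ^ 2 * fH ustar)
          ∂(sphMeasure n)) ∂(sphMeasure n) ∧
    (∫ v, (∫ u in S, Gop n S SH η βk fH h v u * (h v u / M u)) ∂(sphMeasure n)) ≤ 0 := by
  have := sph_fin_aux n
  set a := sphMeasure n with ha
  set b : Measure ℝ := volume.restrict S with hb
  set c : Measure ℝ := volume.restrict SH with hc
  have mp1 := mp1_aux a b c
  have mp2 := mp2_aux a b c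
  have me2 : MeasurableEmbedding (fun p : Sph n × Sph n × ℝ × ℝ × ℝ =>
      (((p.1, p.2.2.1), (p.2.1, p.2.2.2.1)), p.2.2.2.2)) := by
    refine MeasurableEmbedding.of_measurable_inverse
      (g := fun q : ((Sph n × ℝ) × (Sph n × ℝ)) × ℝ =>
        (q.1.1.1, q.1.2.1, q.1.1.2, q.1.2.2, q.2)) mp2.measurable ?_ (by fun_prop)
      (fun _ => rfl)
    convert MeasurableSet.univ
    exact Set.range_eq_univ.mpr fun q => ⟨(q.1.1.1, q.1.2.1, q.1.1.2, q.1.2.2, q.2), rfl⟩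
  have me1 : MeasurableEmbedding (fun p : Sph n × ℝ × Sph n × ℝ × ℝ =>
      (((p.1, p.2.1), (p.2.2.1, p.2.2.2.2)), p.2.2.2.1)) := by
    refine MeasurableEmbedding.of_measurable_inverse
      (g := fun q : ((Sph n × ℝ) × (Sph n × ℝ)) × ℝ =>
        (q.1.1.1, q.1.1.2, q.1.2.1, q.2, q.1.2.2)) mp1.measurable ?_ (by fun_prop)
      (fun _ => rfl)
    convert MeasurableSet.univ
    exact Set.range_eq_univ.mpr fun q => ⟨(q.1.1.1, q.1.1.2, q.1.2.1, q.2, q.1.2.2), rfl⟩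
  have hAi : ∀ u ∈ S, ∀ w ∈ S, Integrable (fun s => η u s * βk w u s * fH s) c := by
    intro u hu w hw
    by_contra hni
    have := hlb u hu w hw
    rw [integral_undef hni] at this
    exact absurd this (not_le.mpr (mul_pos hγ (hMpos w hw)))
  have hGae : ∀ᵐ x ∂(a.prod b), x.2 ∈ S :=
    (quasiMeasurePreserving_snd (μ := a) (ν := b)).ae (ae_restrict_mem hS)
  have hGGY : ∀ᵐ p ∂(((a.prod b).prod (a.prod b)).prod c), p.1.1.2 ∈ S ∧ p.1.2.2 ∈ S := by
    have a1 := (quasiMeasurePreserving_fst (μ := a.prod b) (ν := a.prod b)).ae hGae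
    have a2 := (quasiMeasurePreserving_snd (μ := a.prod b) (ν := a.prod b)).ae hGae
    refine (quasiMeasurePreserving_fst (μ := (a.prod b).prod (a.prod b)) (ν := c)).ae
      (p := fun q => q.1.2 ∈ S ∧ q.2.2 ∈ S) ?_
    filter_upwards [a1, a2] with q h1 h2 using ⟨h1, h2⟩
  have hAm : AEStronglyMeasurable (fun p : ((Sph n × ℝ) × (Sph n × ℝ)) × ℝ =>
      η p.1.1.2 p.2 * βk p.1.2.2 p.1.1.2 p.2 * fH p.2)
      (((a.prod b).prod (a.prod b)).prod c) := by
    have x1 : Measurable (fun p : ((Sph n × ℝ) × (Sph n × ℝ)) × ℝ => η p.1.1.2 p.2) :=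
      hηmeas.comp (by fun_prop : Measurable
        (fun p : ((Sph n × ℝ) × (Sph n × ℝ)) × ℝ => (p.1.1.2, p.2)))
    have x2 : Measurable (fun p : ((Sph n × ℝ) × (Sph n × ℝ)) × ℝ =>
        βk p.1.2.2 p.1.1.2 p.2) :=
      hβmeas.comp (by fun_prop : Measurable
        (fun p : ((Sph n × ℝ) × (Sph n × ℝ)) × ℝ => (p.1.2.2, p.1.1.2, p.2)))
    exact (x1.mul x2).aestronglyMeasurable.mul
      (hfHint.aestronglyMeasurable.comp_quasiMeasurePreserving quasiMeasurePreserving_snd)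
  have hgm : Measurable (fun x : Sph n × ℝ => h x.1 x.2 / M x.2) :=
    hhmeas.div (hMmeas.comp measurable_snd)
  have hint2 : Integrable (fun p : ((Sph n × ℝ) × (Sph n × ℝ)) × ℝ =>
      η p.1.1.2 p.2 * βk p.1.2.2 p.1.1.2 p.2 * fH p.2 *
        (h p.1.1.1 p.1.1.2 ^ 2 / M p.1.1.2 + h p.1.2.1 p.1.2.2 ^ 2 / M p.1.2.2))
      (((a.prod b).prod (a.prod b)).prod c) := (mp2.integrable_comp_emb me2).mp hint
  have h1 : Integrable (fun p : ((Sph n × ℝ) × (Sph n × ℝ)) × ℝ =>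
      η p.1.1.2 p.2 * βk p.1.2.2 p.1.1.2 p.2 * fH p.2 * M p.1.1.2 *
        (h p.1.1.1 p.1.1.2 / M p.1.1.2) ^ 2)
      (((a.prod b).prod (a.prod b)).prod c) := by
    have y1 : Measurable fun p : ((Sph n × ℝ) × (Sph n × ℝ)) × ℝ => M p.1.1.2 := by fun_prop
    have y2 : Measurable fun p : ((Sph n × ℝ) × (Sph n × ℝ)) × ℝ =>
        h p.1.1.1 p.1.1.2 / M p.1.1.2 := hgm.comp (by fun_prop : Measurable
          fun p : ((Sph n × ℝ) × (Sph n × ℝ)) × ℝ => p.1.1)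
    refine hint2.mono' ((hAm.mul y1.aestronglyMeasurable).mul
      (y2.pow_const 2).aestronglyMeasurable) ?_
    filter_upwards [hGGY] with p hp
    have z1 := hMpos _ hp.1
    have z2 := hMpos _ hp.2
    have z3 : 0 ≤ η p.1.1.2 p.2 * βk p.1.2.2 p.1.1.2 p.2 * fH p.2 :=
      mul_nonneg (mul_nonneg (hηnn _ _) (hβnn _ _ _)) (hfHnn _)
    rw [Real.norm_of_nonneg (by positivity), mul_assoc]
    refine mul_le_mul_of_nonneg_left ?_ z3
    have : M p.1.1.2 * (h p.1.1.1 p.1.1.2 / M p.1.1.2) ^ 2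
        = h p.1.1.1 p.1.1.2 ^ 2 / M p.1.1.2 := by field_simp
    rw [this]
    have : 0 ≤ h p.1.2.1 p.1.2.2 ^ 2 / M p.1.2.2 := by positivity
    linarith
  obtain ⟨hT, hR, hTR, hR0⟩ := abs_aux (a.prod b) c
    (fun x y s => η x.2 s * βk y.2 x.2 s * fH s) hAm
    (fun x y s => mul_nonneg (mul_nonneg (hηnn _ _) (hβnn _ _ _)) (hfHnn _))
    (fun x => M x.2) (fun x => h x.1 x.2 / M x.2) (hMmeas.comp measurable_snd) hgm
    (fun x => x.2 ∈ S) hGae (fun x hx => hMpos _ hx) (fun x y hx hy => hAi _ hx _ hy)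
    (by
      intro x y hx hy
      have i1 := (hAi _ hx _ hy).mul_const (M x.2)
      have i2 := (hAi _ hy _ hx).mul_const (M y.2)
      have := hdb _ hx _ hy
      have e : (fun s => (η x.2 s * βk y.2 x.2 s * M x.2 - η y.2 s * βk x.2 y.2 s * M y.2) * fH s)
          = fun s => η x.2 s * βk y.2 x.2 s * fH s * M x.2
            - η y.2 s * βk x.2 y.2 s * fH s * M y.2 := by
        funext s; ring
      rw [e, integral_sub i1 i2, integral_mul_const, integral_mul_const] at this
      linarith) h1
  -- right-hand side
  have hRHS : (∫ v, (∫ v', (∫ u in S, ∫ w in S, ∫ ustar in SH,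
            η u ustar * βk w u ustar * M u *
              (h v u / M u - h v' w / M w) ^ 2 * fH ustar) ∂a) ∂a) =
      ∫ p : ((Sph n × ℝ) × (Sph n × ℝ)) × ℝ,
        η p.1.1.2 p.2 * βk p.1.2.2 p.1.1.2 p.2 * fH p.2 * M p.1.1.2 *
        (h p.1.1.1 p.1.1.2 / M p.1.1.2 - h p.1.2.1 p.1.2.2 / M p.1.2.2) ^ 2
        ∂(((a.prod b).prod (a.prod b)).prod c) := by
    refine Eq.trans ?_ (iter5_comp_aux a a b b c _ _ _ mp2 me2 hR)
    congr! 10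
    ring
  have hTae : (fun p : ((Sph n × ℝ) × (Sph n × ℝ)) × ℝ =>
        η p.1.2.2 p.2 * βk p.1.1.2 p.1.2.2 p.2 * fH p.2 * M p.1.2.2 *
          (h p.1.2.1 p.1.2.2 / M p.1.2.2) * (h p.1.1.1 p.1.1.2 / M p.1.1.2)
        - η p.1.1.2 p.2 * βk p.1.2.2 p.1.1.2 p.2 * fH p.2 * M p.1.1.2 *
          (h p.1.1.1 p.1.1.2 / M p.1.1.2) ^ 2)
      =ᵐ[((a.prod b).prod (a.prod b)).prod c]
      (fun p => (η p.1.2.2 p.2 * βk p.1.1.2 p.1.2.2 p.2 * h p.1.2.1 p.1.2.2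
        - η p.1.1.2 p.2 * βk p.1.2.2 p.1.1.2 p.2 * h p.1.1.1 p.1.1.2) * fH p.2
          * (h p.1.1.1 p.1.1.2 / M p.1.1.2)) := by
    filter_upwards [hGGY] with p hp
    have z1 := (hMpos _ hp.1).ne'
    have z2 := (hMpos _ hp.2).ne'
    field_simp
  have hT' := hT.congr hTae
  have hLHS : (∫ v, (∫ u in S, Gop n S SH η βk fH h v u * (h v u / M u)) ∂a) =
      ∫ p : ((Sph n × ℝ) × (Sph n × ℝ)) × ℝ,
        (η p.1.2.2 p.2 * βk p.1.1.2 p.1.2.2 p.2 * h p.1.2.1 p.1.2.2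
        - η p.1.1.2 p.2 * βk p.1.2.2 p.1.1.2 p.2 * h p.1.1.1 p.1.1.2) * fH p.2
          * (h p.1.1.1 p.1.1.2 / M p.1.1.2)
        ∂(((a.prod b).prod (a.prod b)).prod c) := by
    refine Eq.trans ?_ (iter5_comp_aux a b a c b _ _ _ mp1 me1 hT')
    simp only [Gop, integral_mul_const]
    first | done | rfl
  rw [integral_congr_ae hTae] at hTR
  rw [hLHS, hRHS]
  refine ⟨hTR, ?_⟩
  rw [hTR]
  linarith
end
end

section
/- Coercivity of the negative kinetic operator on mean-zero functions: under Assumption A, for every measurable h : V × Σ → ℝ with ∫_V ∫_Σ h(v̂,u) du dv̂ = 0, such that h²/M is integrable on V × Σ and the map (v̂, v̂', u, w, u_*) ↦ η(u,u_*) β(w; u,u_*) f_H(u_*) (h(v̂,u)²/M(u) + h(v̂',w)²/M(w)) is integrable on V × V × Σ × Σ × Σ_H, one has −∫_V ∫_Σ G[h](v̂,u) · (h(v̂,u)/M(u)) du dv̂ ≥ γ ∫_V ∫_Σ h(v̂,u)²/M(u) du dv̂. -/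
open MeasureTheory Measure

noncomputable section

theorem abs_coer {X T : Type*} [MeasurableSpace X] [MeasurableSpace T] (μ : Measure X)
    (ν : Measure T) [SFinite μ] [SFinite ν] (a : X → X → T → ℝ) (M h : X → ℝ) (P : Set X)
    (hP : ∀ᵐ x ∂μ, x ∈ P) (γ : ℝ)
    (ha0 : ∀ x y s, 0 ≤ a x y s)
    (ham : AEStronglyMeasurable (fun p : (X × X) × T => a p.1.2 p.1.1 p.2) ((μ.prod μ).prod ν))
    (hM : Measurable M) (hh : Measurable h) (hMpos : ∀ x ∈ P, 0 < M x)
    (hai : ∀ x ∈ P, ∀ y ∈ P, Integrable (a x y) ν)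
    (hdb : ∀ x ∈ P, ∀ y ∈ P, (∫ s, a x y s ∂ν) * M x = (∫ s, a y x s ∂ν) * M y)
    (hlb : ∀ x ∈ P, ∀ y ∈ P, γ * M y ≤ ∫ s, a x y s ∂ν)
    (hMi : Integrable M μ) (hM1 : ∫ x, M x ∂μ = 1)
    (hhi : Integrable h μ) (hh0 : ∫ x, h x ∂μ = 0)
    (hsq : Integrable (fun x => h x ^ 2 / M x) μ)
    (hD : Integrable (fun p : (X × X) × T => a p.1.1 p.1.2 p.2 * (h p.1.1 ^ 2 / M p.1.1))
      ((μ.prod μ).prod ν)) :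
    Integrable (fun p : (X × X) × T => (a p.1.2 p.1.1 p.2 * h p.1.2 - a p.1.1 p.1.2 p.2 * h p.1.1)
        * (h p.1.1 / M p.1.1)) ((μ.prod μ).prod ν) ∧
    γ * ∫ x, h x ^ 2 / M x ∂μ ≤
      - ∫ p : (X × X) × T, (a p.1.2 p.1.1 p.2 * h p.1.2 - a p.1.1 p.1.2 p.2 * h p.1.1)
        * (h p.1.1 / M p.1.1) ∂((μ.prod μ).prod ν) := by
  set K : X → X → ℝ := fun x y => ∫ s, a x y s ∂ν with hK
  have hPP : ∀ᵐ p ∂(μ.prod μ), p.1 ∈ P ∧ p.2 ∈ P :=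
    (quasiMeasurePreserving_fst.ae hP).and (quasiMeasurePreserving_snd.ae hP)
  have hK0 : ∀ x y, 0 ≤ K x y := fun x y => integral_nonneg (ha0 x y)
  have hI1 : Integrable (fun p : X × X => K p.1 p.2 * (h p.1 ^ 2 / M p.1)) (μ.prod μ) := by
    have := hD.integral_prod_left
    simpa only [integral_mul_const] using this
  have hI2 : Integrable (fun p : X × X => K p.2 p.1 * (h p.2 ^ 2 / M p.2)) (μ.prod μ) := hI1.swap
  have hKm : AEStronglyMeasurable (fun p : X × X => K p.2 p.1) (μ.prod μ) := ham.integral_prod_right'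
  have hCm : AEStronglyMeasurable (fun p : X × X => h p.2 * (h p.1 / M p.1)) (μ.prod μ) := by
    apply Measurable.aestronglyMeasurable; fun_prop
  have hI3 : Integrable (fun p : X × X => K p.2 p.1 * (h p.2 * (h p.1 / M p.1))) (μ.prod μ) := by
    refine (hI1.add hI2).mono' (hKm.mul hCm) ?_
    filter_upwards [hPP] with p hp
    obtain ⟨h1, h2⟩ := hp
    have m1 := hMpos _ h1
    have m2 := hMpos _ h2
    have e : K p.1 p.2 = K p.2 p.1 * M p.2 / M p.1 := by
      rw [eq_div_iff m1.ne']; exact hdb _ h1 _ h2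
    simp only [Pi.add_apply, Real.norm_eq_abs]
    have e1 : K p.1 p.2 * (h p.1 ^ 2 / M p.1) + K p.2 p.1 * (h p.2 ^ 2 / M p.2)
      = K p.2 p.1 * M p.2 * ((h p.1 / M p.1) ^ 2 + (h p.2 / M p.2) ^ 2) := by
      rw [e]; field_simp
    have e2 : K p.2 p.1 * (h p.2 * (h p.1 / M p.1))
      = K p.2 p.1 * M p.2 * ((h p.1 / M p.1) * (h p.2 / M p.2)) := by
      field_simp
    have kp : 0 ≤ K p.2 p.1 * M p.2 := mul_nonneg (hK0 _ _) m2.le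
    rw [e1, e2, abs_mul, abs_of_nonneg kp]
    refine mul_le_mul_of_nonneg_left ?_ kp
    rw [abs_le]
    constructor <;> nlinarith [sq_nonneg (h p.1 / M p.1 + h p.2 / M p.2),
      sq_nonneg (h p.1 / M p.1 - h p.2 / M p.2), sq_nonneg (h p.1 / M p.1), sq_nonneg (h p.2 / M p.2)]
  have hC : Integrable (fun p : (X × X) × T => a p.1.2 p.1.1 p.2 * (h p.1.2 * (h p.1.1 / M p.1.1)))
      ((μ.prod μ).prod ν) := by
    have hCm2 : AEStronglyMeasurable (fun p : (X × X) × T =>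
        a p.1.2 p.1.1 p.2 * (h p.1.2 * (h p.1.1 / M p.1.1))) ((μ.prod μ).prod ν) :=
      ham.mul hCm.comp_fst
    refine (integrable_prod_iff hCm2).2 ⟨?_, ?_⟩
    · filter_upwards [hPP] with p hp
      exact (hai _ hp.2 _ hp.1).mul_const _
    · refine hI3.norm.congr (Filter.Eventually.of_forall fun p => ?_)
      simp only [norm_mul, integral_mul_const]
      congr 1
      rw [Real.norm_of_nonneg (hK0 _ _)]
      exact integral_congr_ae (Filter.Eventually.of_forall fun s =>
        (Real.norm_of_nonneg (ha0 _ _ _)).symm)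
  have hFe : (fun p : (X × X) × T => (a p.1.2 p.1.1 p.2 * h p.1.2 - a p.1.1 p.1.2 p.2 * h p.1.1)
        * (h p.1.1 / M p.1.1)) = fun p => a p.1.2 p.1.1 p.2 * (h p.1.2 * (h p.1.1 / M p.1.1)) -
          a p.1.1 p.1.2 p.2 * (h p.1.1 ^ 2 / M p.1.1) := by
    funext p; ring
  rw [hFe]
  refine ⟨hC.sub hD, ?_⟩
  rw [integral_sub hC hD, integral_prod _ hC, integral_prod _ hD]
  simp only [integral_mul_const]
  change _ ≤ -((∫ p : X × X, K p.2 p.1 * (h p.2 * (h p.1 / M p.1)) ∂(μ.prod μ)) -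
    ∫ p : X × X, K p.1 p.2 * (h p.1 ^ 2 / M p.1) ∂(μ.prod μ))
  have s1 : ∫ p : X × X, K p.2 p.1 * (h p.2 ^ 2 / M p.2) ∂(μ.prod μ) =
      ∫ p : X × X, K p.1 p.2 * (h p.1 ^ 2 / M p.1) ∂(μ.prod μ) :=
    integral_prod_swap (fun p : X × X => K p.1 p.2 * (h p.1 ^ 2 / M p.1))
  have J1 : Integrable (fun p : X × X => h p.1 ^ 2 / M p.1 * M p.2) (μ.prod μ) := hsq.mul_prod hMi
  have J2 : Integrable (fun p : X × X => M p.1 * (h p.2 ^ 2 / M p.2)) (μ.prod μ) := hMi.mul_prod hsq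
  have J3 : Integrable (fun p : X × X => h p.1 * h p.2) (μ.prod μ) := hhi.mul_prod hhi
  have v1 : ∫ p : X × X, h p.1 ^ 2 / M p.1 * M p.2 ∂(μ.prod μ) = ∫ x, h x ^ 2 / M x ∂μ := by
    rw [integral_prod_mul (fun x => h x ^ 2 / M x) M, hM1, mul_one]
  have v2 : ∫ p : X × X, M p.1 * (h p.2 ^ 2 / M p.2) ∂(μ.prod μ) = ∫ x, h x ^ 2 / M x ∂μ := by
    rw [integral_prod_mul M (fun x => h x ^ 2 / M x), hM1, one_mul]
  have v3 : ∫ p : X × X, h p.1 * h p.2 ∂(μ.prod μ) = 0 := by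
    rw [integral_prod_mul h h, hh0, mul_zero]
  have key := integral_mono_ae (((J1.add J2).sub (J3.const_mul 2)).const_mul γ)
    ((hI1.add hI2).sub (hI3.const_mul 2)) (by
    filter_upwards [hPP] with p hp
    obtain ⟨h1, h2⟩ := hp
    have m1 := hMpos _ h1
    have m2 := hMpos _ h2
    have e : K p.1 p.2 = K p.2 p.1 * M p.2 / M p.1 := by
      rw [eq_div_iff m1.ne']; exact hdb _ h1 _ h2
    simp only [Pi.add_apply, Pi.sub_apply]
    have e1 : K p.1 p.2 * (h p.1 ^ 2 / M p.1) + K p.2 p.1 * (h p.2 ^ 2 / M p.2) -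
        2 * (K p.2 p.1 * (h p.2 * (h p.1 / M p.1)))
      = K p.2 p.1 * (M p.2 * (h p.1 / M p.1 - h p.2 / M p.2) ^ 2) := by
      rw [e]; field_simp; ring
    have e2 : γ * (h p.1 ^ 2 / M p.1 * M p.2 + M p.1 * (h p.2 ^ 2 / M p.2) - 2 * (h p.1 * h p.2))
      = (γ * M p.1) * (M p.2 * (h p.1 / M p.1 - h p.2 / M p.2) ^ 2) := by
      field_simp; ring
    rw [e1, e2]
    exact mul_le_mul_of_nonneg_right (hlb _ h2 _ h1) (by positivity))
  rw [integral_const_mul, integral_sub' (J1.add J2) (J3.const_mul 2), integral_add' J1 J2,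
    integral_const_mul, integral_sub' (hI1.add hI2) (hI3.const_mul 2), integral_add' hI1 hI2,
    integral_const_mul, v1, v2, v3, s1] at key
  linarith

theorem shuffle_mp {V : Type*} [MeasurableSpace V] (m : Measure V) [SFinite m]
    (σ τ : Measure ℝ) [SFinite σ] [SFinite τ] :
    MeasurePreserving (fun p : ((V × ℝ) × (V × ℝ)) × ℝ =>
      ((p.1.1.1, p.1.2.1, p.1.1.2, p.1.2.2, p.2) : V × V × ℝ × ℝ × ℝ))
      (((m.prod σ).prod (m.prod σ)).prod τ) (m.prod (m.prod (σ.prod (σ.prod τ)))) := by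
  have s1 := measurePreserving_prodAssoc (m.prod σ) (m.prod σ) τ
  have s2 := measurePreserving_prodAssoc m σ ((m.prod σ).prod τ)
  have s3 := (MeasurePreserving.id σ).prod (measurePreserving_prodAssoc m σ τ)
  have s4 := (measurePreserving_prodAssoc σ m (σ.prod τ)).symm
  have s5 := (measurePreserving_swap (μ := σ) (ν := m)).prod (MeasurePreserving.id (σ.prod τ))
  have s6 := measurePreserving_prodAssoc m σ (σ.prod τ)
  have t := s6.comp (s5.comp (s4.comp s3))
  exact (((MeasurePreserving.id m).prod t).comp s2).comp s1

theorem inner_swap {V : Type*} [MeasurableSpace V] (m : Measure V) [SFinite m]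
    (σ τ : Measure ℝ) [SFinite σ] [SFinite τ] (F : (V × ℝ) × ℝ → ℝ)
    (hF : Integrable F ((m.prod σ).prod τ)) :
    ∫ v, ∫ s, ∫ w, F ((v, w), s) ∂σ ∂τ ∂m = ∫ p, F p ∂((m.prod σ).prod τ) := by
  have e := measurePreserving_prodAssoc m σ τ
  have hG : Integrable (fun q : V × ℝ × ℝ => F ((q.1, q.2.1), q.2.2)) (m.prod (σ.prod τ)) :=
    e.symm.integrable_comp_of_integrable hF
  rw [integral_prod _ hF, integral_prod _ hF.integral_prod_left]
  apply integral_congr_ae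
  filter_upwards [hG.prod_right_ae] with v hv
  exact (integral_integral_swap (f := fun w s => F ((v, w), s)) hv).symm

instance sph_fin (n : ℕ) : IsFiniteMeasure (sphMeasure n) := by
  unfold sphMeasure; infer_instance

/-- Coercivity of the negative kinetic operator on mean-zero functions, under
Assumption A: `−∫∫ G[h]·(h/M) ≥ γ ∫∫ h²/M`. -/
theorem stmt2 (n : ℕ) (hn : 1 ≤ n) (S SH : Set ℝ)
    (hS : MeasurableSet S) (hSH : MeasurableSet SH)
    (η : ℝ → ℝ → ℝ) (hηmeas : Measurable (Function.uncurry η))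
    (hηnn : ∀ u ustar, 0 ≤ η u ustar)
    (βk : ℝ → ℝ → ℝ → ℝ) (hβmeas : Measurable fun p : ℝ × ℝ × ℝ => βk p.1 p.2.1 p.2.2)
    (hβnn : ∀ u u' ustar, 0 ≤ βk u u' ustar)
    (fH : ℝ → ℝ) (hfHnn : ∀ ustar, 0 ≤ fH ustar) (hfHint : IntegrableOn fH SH)
    -- Assumption A
    (M : ℝ → ℝ) (hMmeas : Measurable M) (hMpos : ∀ u ∈ S, 0 < M u)
    (hMnorm : (∫ _v, (∫ u in S, M u) ∂(sphMeasure n)) = 1)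
    (hMmean : (∫ u in S, u * M u) = 0)
    (hdb : ∀ w ∈ S, ∀ u ∈ S,
      (∫ ustar in SH,
        (η w ustar * βk u w ustar * M w - η u ustar * βk w u ustar * M u) * fH ustar) = 0)
    (γ : ℝ) (hγ : 0 < γ)
    (hlb : ∀ w ∈ S, ∀ u ∈ S,
      γ * M u ≤ ∫ ustar in SH, η w ustar * βk u w ustar * fH ustar)
    -- the function h, mean-zero, with its integrability
    (h : Sph n → ℝ → ℝ) (hhmeas : Measurable (Function.uncurry h))
    (hzero : (∫ v, (∫ u in S, h v u) ∂(sphMeasure n)) = 0)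
    (hsq : Integrable (fun p : Sph n × ℝ => h p.1 p.2 ^ 2 / M p.2)
      ((sphMeasure n).prod (volume.restrict S)))
    (hint : Integrable
      (fun p : Sph n × Sph n × ℝ × ℝ × ℝ =>
        η p.2.2.1 p.2.2.2.2 * βk p.2.2.2.1 p.2.2.1 p.2.2.2.2 * fH p.2.2.2.2 *
          (h p.1 p.2.2.1 ^ 2 / M p.2.2.1 + h p.2.1 p.2.2.2.1 ^ 2 / M p.2.2.2.1))
      ((sphMeasure n).prod ((sphMeasure n).prod
        ((volume.restrict S).prod ((volume.restrict S).prod (volume.restrict SH)))))) :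
    γ * (∫ v, (∫ u in S, h v u ^ 2 / M u) ∂(sphMeasure n)) ≤
      -(∫ v, (∫ u in S, Gop n S SH η βk fH h v u * (h v u / M u)) ∂(sphMeasure n)) := by
  set m := sphMeasure n with hm
  set σ := (volume : Measure ℝ).restrict S with hσ
  set τ := (volume : Measure ℝ).restrict SH with hτ
  have hMi : Integrable M σ := by
    by_contra hc
    rw [integral_undef hc] at hMnorm
    simp at hMnorm
  have hMi2 : Integrable (fun p : Sph n × ℝ => M p.2) (m.prod σ) := hMi.comp_snd m
  have hM1 : ∫ p : Sph n × ℝ, M p.2 ∂(m.prod σ) = 1 := by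
    rw [integral_prod _ hMi2]; exact hMnorm
  have hPσ : ∀ᵐ u ∂σ, u ∈ S := ae_restrict_mem hS
  have hP : ∀ᵐ p ∂(m.prod σ), p ∈ {p : Sph n × ℝ | p.2 ∈ S} := quasiMeasurePreserving_snd.ae hPσ
  have hhm : Measurable (fun p : Sph n × ℝ => h p.1 p.2) := hhmeas
  have hhi : Integrable (fun p : Sph n × ℝ => h p.1 p.2) (m.prod σ) := by
    refine (hsq.add hMi2).mono' hhm.aestronglyMeasurable ?_
    filter_upwards [hP] with p hp
    have mp := hMpos _ hp
    simp only [Pi.add_apply, Real.norm_eq_abs]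
    rw [← sub_nonneg]
    have : h p.1 p.2 ^ 2 / M p.2 + M p.2 - |h p.1 p.2| =
      ((|h p.1 p.2| - M p.2) ^ 2 + |h p.1 p.2| * M p.2) / M p.2 := by
      rw [← sq_abs (h p.1 p.2)]; field_simp; ring
    rw [this]; positivity
  have hh0 : ∫ p : Sph n × ℝ, h p.1 p.2 ∂(m.prod σ) = 0 := by
    rw [integral_prod _ hhi]; exact hzero
  have hai : ∀ w ∈ S, ∀ u ∈ S, Integrable (fun s => η w s * βk u w s * fH s) τ := by
    intro w hw u hu
    by_contra hc
    have := hlb w hw u hu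
    rw [integral_undef hc] at this
    exact absurd this (not_le.2 (mul_pos hγ (hMpos u hu)))
  have hdb' : ∀ w ∈ S, ∀ u ∈ S, (∫ s, η w s * βk u w s * fH s ∂τ) * M w =
      (∫ s, η u s * βk w u s * fH s ∂τ) * M u := by
    intro w hw u hu
    have := hdb w hw u hu
    rw [← sub_eq_zero, ← integral_mul_const, ← integral_mul_const,
      ← integral_sub ((hai w hw u hu).mul_const _) ((hai u hu w hw).mul_const _), ← this]
    congr 1; funext s; ring
  have hfm : AEStronglyMeasurable (fun p : ((Sph n × ℝ) × (Sph n × ℝ)) × ℝ => fH p.2)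
      (((m.prod σ).prod (m.prod σ)).prod τ) := hfHint.1.comp_snd
  have hηβ1 : Measurable (fun p : ((Sph n × ℝ) × (Sph n × ℝ)) × ℝ =>
      η p.1.1.2 p.2 * βk p.1.2.2 p.1.1.2 p.2) :=
    (hηmeas.comp (by fun_prop : Measurable fun p : ((Sph n × ℝ) × (Sph n × ℝ)) × ℝ =>
      (p.1.1.2, p.2))).mul
    (hβmeas.comp (by fun_prop : Measurable fun p : ((Sph n × ℝ) × (Sph n × ℝ)) × ℝ =>
      (p.1.2.2, p.1.1.2, p.2)))
  have hηβ2 : Measurable (fun p : ((Sph n × ℝ) × (Sph n × ℝ)) × ℝ =>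
      η p.1.2.2 p.2 * βk p.1.1.2 p.1.2.2 p.2) :=
    (hηmeas.comp (by fun_prop : Measurable fun p : ((Sph n × ℝ) × (Sph n × ℝ)) × ℝ =>
      (p.1.2.2, p.2))).mul
    (hβmeas.comp (by fun_prop : Measurable fun p : ((Sph n × ℝ) × (Sph n × ℝ)) × ℝ =>
      (p.1.1.2, p.1.2.2, p.2)))
  have hqm : Measurable (fun p : Sph n × ℝ => h p.1 p.2 ^ 2 / M p.2) := by fun_prop
  have hD : Integrable (fun p : ((Sph n × ℝ) × (Sph n × ℝ)) × ℝ =>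
      (η p.1.1.2 p.2 * βk p.1.2.2 p.1.1.2 p.2 * fH p.2) * (h p.1.1.1 p.1.1.2 ^ 2 / M p.1.1.2))
      (((m.prod σ).prod (m.prod σ)).prod τ) := by
    have h0 := (shuffle_mp m σ τ).integrable_comp_of_integrable hint
    refine h0.mono' ((hηβ1.aestronglyMeasurable.mul hfm).mul
      (hqm.comp (by fun_prop : Measurable fun p : ((Sph n × ℝ) × (Sph n × ℝ)) × ℝ =>
      p.1.1)).aestronglyMeasurable) ?_
    have hPP : ∀ᵐ p ∂(((m.prod σ).prod (m.prod σ)).prod τ), p.1.1.2 ∈ S ∧ p.1.2.2 ∈ S :=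
      quasiMeasurePreserving_fst.ae
        ((quasiMeasurePreserving_fst.ae hP).and (quasiMeasurePreserving_snd.ae hP))
    filter_upwards [hPP] with p hp
    have m1 := hMpos _ hp.1
    have m2 := hMpos _ hp.2
    have k0 : 0 ≤ η p.1.1.2 p.2 * βk p.1.2.2 p.1.1.2 p.2 * fH p.2 :=
      mul_nonneg (mul_nonneg (hηnn _ _) (hβnn _ _ _)) (hfHnn _)
    rw [Real.norm_of_nonneg (by positivity)]
    simp only [Function.comp]
    refine mul_le_mul_of_nonneg_left ?_ k0
    have : 0 ≤ h p.1.2.1 p.1.2.2 ^ 2 / M p.1.2.2 := by positivity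
    linarith
  obtain ⟨hF, hmain⟩ := abs_coer (m.prod σ) τ
    (fun x y s => η x.2 s * βk y.2 x.2 s * fH s) (fun x => M x.2) (fun x => h x.1 x.2)
    {p | p.2 ∈ S} hP γ
    (fun x y s => mul_nonneg (mul_nonneg (hηnn _ _) (hβnn _ _ _)) (hfHnn _))
    (hηβ2.aestronglyMeasurable.mul hfm) (by fun_prop) hhm (fun x hx => hMpos _ hx)
    (fun x hx y hy => hai _ hx _ hy) (fun x hx y hy => hdb' _ hx _ hy)
    (fun x hx y hy => hlb _ hx _ hy) hMi2 hM1 hhi hh0 hsq hD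
  have r1 : ∫ v, (∫ u, h v u ^ 2 / M u ∂σ) ∂m = ∫ x : Sph n × ℝ, h x.1 x.2 ^ 2 / M x.2 ∂(m.prod σ) :=
    (integral_prod _ hsq).symm
  rw [r1]
  refine hmain.trans (le_of_eq ?_)
  congr 1
  have hF' := (measurePreserving_prodAssoc (m.prod σ) (m.prod σ) τ).symm.integrable_comp_of_integrable hF
  have e0 := (measurePreserving_prodAssoc (m.prod σ) (m.prod σ) τ).symm.integral_comp'
    (fun p : ((Sph n × ℝ) × (Sph n × ℝ)) × ℝ =>
    ((η p.1.2.2 p.2 * βk p.1.1.2 p.1.2.2 p.2 * fH p.2) * h p.1.2.1 p.1.2.2 -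
     (η p.1.1.2 p.2 * βk p.1.2.2 p.1.1.2 p.2 * fH p.2) * h p.1.1.1 p.1.1.2) *
      (h p.1.1.1 p.1.1.2 / M p.1.1.2))
  have hG : (fun x : Sph n × ℝ => Gop n S SH η βk fH h x.1 x.2 * (h x.1 x.2 / M x.2)) =ᵐ[m.prod σ]
      fun x => ∫ q : (Sph n × ℝ) × ℝ, 
    ((η q.1.2 q.2 * βk x.2 q.1.2 q.2 * fH q.2) * h q.1.1 q.1.2 -
     (η x.2 q.2 * βk q.1.2 x.2 q.2 * fH q.2) * h x.1 x.2) *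
      (h x.1 x.2 / M x.2) ∂((m.prod σ).prod τ) := by
    filter_upwards [hF'.prod_right_ae] with x hx
    have := inner_swap m σ τ _ hx
    refine Eq.trans ?_ this
    unfold Gop
    rw [← integral_mul_const]
    refine congrArg _ (funext fun v => ?_)
    rw [← integral_mul_const]
    refine congrArg _ (funext fun s => ?_)
    rw [← integral_mul_const]
    refine congrArg _ (funext fun w => ?_)
    simp only [Function.comp, MeasurableEquiv.prodAssoc, MeasurableEquiv.symm, MeasurableEquiv.coe_mk,
      Equiv.prodAssoc, Equiv.symm, Equiv.coe_fn_mk]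
    ring
  have hGi : Integrable (fun x : Sph n × ℝ => Gop n S SH η βk fH h x.1 x.2 * (h x.1 x.2 / M x.2))
      (m.prod σ) := (integrable_congr hG).2 hF'.integral_prod_left
  refine e0.symm.trans ?_
  refine (integral_prod _ hF').trans ?_
  refine Eq.trans ?_ (integral_prod _ hGi)
  exact (integral_congr_ae hG).symm
end
end

section
/- Solvability lemma for the kinetic operator (Lemma 1): under Assumption A and the continuity bound, let H denote the weighted L² space of measurable functions h : V × Σ → ℝ with ∫_V ∫_Σ h(v̂,u)²/M(u) du dv̂ < ∞, and let H₀ = { h ∈ H : ∫_V ∫_Σ h(v̂,u) du dv̂ = 0 }. Then for every g ∈ H with ∫_V ∫_Σ g(v̂,u) du dv̂ = 0 there exists a unique h ∈ H₀ such that, for every k ∈ H₀, −∫_V ∫_Σ G[h](v̂,u) · (k(v̂,u)/M(u)) du dv̂ = −∫_V ∫_Σ g(v̂,u) · (k(v̂,u)/M(u)) du dv̂ (i.e. h is the unique mean-zero weak solution of G[h] = g). -/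
open MeasureTheory Measure

noncomputable section

/-- Membership in the weighted L² space `H` of measurable functions with
`∫_V ∫_Σ h²/M < ∞`. -/
def memH (n : ℕ) (S : Set ℝ) (M : ℝ → ℝ) (h : Sph n → ℝ → ℝ) : Prop :=
  Measurable (Function.uncurry h) ∧
    Integrable (fun p : Sph n × ℝ => h p.1 p.2 ^ 2 / M p.2)
      ((sphMeasure n).prod (volume.restrict S))

/-- Membership in `H₀ = { h ∈ H : ∫_V ∫_Σ h = 0 }`. -/
def memH0 (n : ℕ) (S : Set ℝ) (M : ℝ → ℝ) (h : Sph n → ℝ → ℝ) : Prop :=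
  memH n S M h ∧ (∫ v, (∫ u in S, h v u) ∂(sphMeasure n)) = 0



section abs
variable {X : Type*} [MeasurableSpace X]

theorem absInt (ν : Measure X) [IsProbabilityMeasure ν] (s : X → X → ℝ)
    (hs : Measurable (Function.uncurry s)) (R : ℝ) (hR : ∀ x y, |s x y| ≤ R)
    (a b : X × X → ℝ) (ha : MemLp a 2 (ν.prod ν)) (hb : MemLp b 2 (ν.prod ν)) :
    Integrable (fun p : X × X => s p.1 p.2 * (a p * b p)) (ν.prod ν) := by
  have h := MemLp.integrable_mul ha hb
  exact h.bdd_mul (c := R) hs.aestronglyMeasurable (Filter.Eventually.of_forall fun p => hR p.1 p.2)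

theorem absKey (ν : Measure X) [IsProbabilityMeasure ν] (s : X → X → ℝ)
    (hs : Measurable (Function.uncurry s)) (hsym : ∀ x y, s x y = s y x)
    (γ R : ℝ) (hR : ∀ x y, |s x y| ≤ R)
    (φ κ : X → ℝ) (hφ : MemLp φ 2 ν) (hκ : MemLp κ 2 ν) :
    Integrable (fun x => (∫ y, s x y * (φ y - φ x) ∂ν) * κ x) ν ∧ 
    γ * (∫ x, φ x * κ x ∂ν) + 1/2 * ∫ p, (s p.1 p.2 - γ) * ((φ p.1 - φ p.2) * (κ p.1 - κ p.2)) ∂(ν.prod ν)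
     = - (∫ x, (∫ y, s x y * (φ y - φ x) ∂ν) * κ x ∂ν) + γ * ((∫ x, φ x ∂ν) * ∫ x, κ x ∂ν) := by
  have f1 : MemLp (fun p : X × X => φ p.1) 2 (ν.prod ν) := hφ.comp_measurePreserving measurePreserving_fst
  have f2 : MemLp (fun p : X × X => φ p.2) 2 (ν.prod ν) := hφ.comp_measurePreserving measurePreserving_snd
  have k1 : MemLp (fun p : X × X => κ p.1) 2 (ν.prod ν) := hκ.comp_measurePreserving measurePreserving_fst
  have k2 : MemLp (fun p : X × X => κ p.2) 2 (ν.prod ν) := hκ.comp_measurePreserving measurePreserving_snd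
  have hF : Integrable (fun p : X × X => s p.1 p.2 * ((φ p.2 - φ p.1) * κ p.1)) (ν.prod ν) :=
    absInt ν s hs R hR _ _ (f2.sub f1) k1
  have hF2 : Integrable (fun p : X × X => s p.1 p.2 * ((φ p.1 - φ p.2) * κ p.2)) (ν.prod ν) :=
    absInt ν s hs R hR _ _ (f1.sub f2) k2
  have e1 : ∀ x, (∫ y, s x y * (φ y - φ x) ∂ν) * κ x = ∫ y, s x y * ((φ y - φ x) * κ x) ∂ν := by
    intro x
    rw [← integral_mul_const]; congr 1; ext y; ring
  have hint : Integrable (fun x => (∫ y, s x y * (φ y - φ x) ∂ν) * κ x) ν := by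
    simp_rw [e1]
    exact hF.integral_prod_left
  refine ⟨hint, ?_⟩
  have e2 : (∫ x, (∫ y, s x y * (φ y - φ x) ∂ν) * κ x ∂ν) = ∫ p, s p.1 p.2 * ((φ p.2 - φ p.1) * κ p.1) ∂(ν.prod ν) := by
    simp_rw [e1]
    exact (integral_prod _ hF).symm
  have e3 : ∫ p, s p.1 p.2 * ((φ p.1 - φ p.2) * κ p.2) ∂(ν.prod ν) = ∫ p, s p.1 p.2 * ((φ p.2 - φ p.1) * κ p.1) ∂(ν.prod ν) := by
    rw [← integral_prod_swap]
    congr 1; ext p; simp [hsym p.2 p.1]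
  have i11 : Integrable (fun p : X × X => φ p.1 * κ p.1) (ν.prod ν) := MemLp.integrable_mul f1 k1
  have i12 : Integrable (fun p : X × X => φ p.1 * κ p.2) (ν.prod ν) := MemLp.integrable_mul f1 k2
  have i21 : Integrable (fun p : X × X => φ p.2 * κ p.1) (ν.prod ν) := MemLp.integrable_mul f2 k1
  have i22 : Integrable (fun p : X × X => φ p.2 * κ p.2) (ν.prod ν) := MemLp.integrable_mul f2 k2
  have v12 : ∫ p : X × X, φ p.1 * κ p.2 ∂(ν.prod ν) = (∫ x, φ x ∂ν) * ∫ x, κ x ∂ν := integral_prod_mul _ _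
  have v21 : ∫ p : X × X, φ p.2 * κ p.1 ∂(ν.prod ν) = (∫ x, φ x ∂ν) * ∫ x, κ x ∂ν := by
    rw [mul_comm, ← integral_prod_mul]; congr 1; ext p; ring
  have v11 : ∫ p : X × X, φ p.1 * κ p.1 ∂(ν.prod ν) = ∫ x, φ x * κ x ∂ν := by
    rw [integral_fun_fst (fun x => φ x * κ x)]; simp
  have v22 : ∫ p : X × X, φ p.2 * κ p.2 ∂(ν.prod ν) = ∫ x, φ x * κ x ∂ν := by
    rw [integral_fun_snd (fun x => φ x * κ x)]; simp
  have e4 : ∫ p, (s p.1 p.2 - γ) * ((φ p.1 - φ p.2) * (κ p.1 - κ p.2)) ∂(ν.prod ν) =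
     - (∫ p, s p.1 p.2 * ((φ p.2 - φ p.1) * κ p.1) ∂(ν.prod ν))
     - (∫ p, s p.1 p.2 * ((φ p.1 - φ p.2) * κ p.2) ∂(ν.prod ν))
     - γ * ((∫ p : X × X, φ p.1 * κ p.1 ∂(ν.prod ν)) - (∫ p : X × X, φ p.1 * κ p.2 ∂(ν.prod ν))
       - (∫ p : X × X, φ p.2 * κ p.1 ∂(ν.prod ν)) + ∫ p : X × X, φ p.2 * κ p.2 ∂(ν.prod ν)) := by
    have j : ∀ p : X × X, (s p.1 p.2 - γ) * ((φ p.1 - φ p.2) * (κ p.1 - κ p.2)) =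
       (-(s p.1 p.2 * ((φ p.2 - φ p.1) * κ p.1)) - s p.1 p.2 * ((φ p.1 - φ p.2) * κ p.2)) -
       γ * (φ p.1 * κ p.1 - φ p.1 * κ p.2 - φ p.2 * κ p.1 + φ p.2 * κ p.2) := fun p => by ring
    simp_rw [j]
    rw [integral_sub, integral_sub, integral_neg, integral_const_mul, integral_add, integral_sub, integral_sub]
    · exact i11
    · exact i12
    · exact i11.sub i12
    · exact i21
    · exact (i11.sub i12).sub i21
    · exact i22
    · exact hF.neg
    · exact hF2
    · exact hF.neg.sub hF2
    · exact (((i11.sub i12).sub i21).add i22).const_mul γ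
  rw [e4, e2, e3, v11, v12, v21, v22]
  ring

theorem absMain (ν : Measure X) [IsProbabilityMeasure ν] (s : X → X → ℝ)
    (hs : Measurable (Function.uncurry s)) (hsym : ∀ x y, s x y = s y x)
    (γ R : ℝ) (hγ : 0 < γ) (hl : ∀ x y, γ ≤ s x y) (hR : ∀ x y, |s x y| ≤ R)
    (g : X → ℝ) (hg : MemLp g 2 ν) (hg0 : ∫ x, g x ∂ν = 0) :
    ∃ φ : X → ℝ, Measurable φ ∧ MemLp φ 2 ν ∧ (∫ x, φ x ∂ν = 0) ∧
      (∀ κ : X → ℝ, MemLp κ 2 ν → (∫ x, κ x ∂ν = 0) →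
        ∫ x, (∫ y, s x y * (φ y - φ x) ∂ν) * κ x ∂ν = ∫ x, g x * κ x ∂ν) ∧
      ∀ φ' : X → ℝ, MemLp φ' 2 ν → (∫ x, φ' x ∂ν = 0) → 
       (∀ κ : X → ℝ, Measurable κ → MemLp κ 2 ν → (∫ x, κ x ∂ν = 0) →
        ∫ x, (∫ y, s x y * (φ' y - φ' x) ∂ν) * κ x ∂ν = ∫ x, g x * κ x ∂ν) → φ' =ᵐ[ν] φ := by
  set P := ν.prod ν with hP
  let D : Lp ℝ 2 ν →L[ℝ] Lp ℝ 2 P :=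
    (Lp.compMeasurePreservingₗᵢ ℝ Prod.fst (measurePreserving_fst (μ := ν) (ν := ν))).toContinuousLinearMap -
    (Lp.compMeasurePreservingₗᵢ ℝ Prod.snd (measurePreserving_snd (μ := ν) (ν := ν))).toContinuousLinearMap
  have hD : ∀ (φ : X → ℝ) (hφ : MemLp φ 2 ν), D (hφ.toLp φ) =ᵐ[P] fun p => φ p.1 - φ p.2 := by
    intro φ hφ
    have h1 := Lp.coeFn_compMeasurePreserving (hφ.toLp φ) (measurePreserving_fst (μ := ν) (ν := ν))
    have h2 := Lp.coeFn_compMeasurePreserving (hφ.toLp φ) (measurePreserving_snd (μ := ν) (ν := ν))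
    have h3 := (measurePreserving_fst (μ := ν) (ν := ν)).quasiMeasurePreserving.ae_eq_comp hφ.coeFn_toLp
    have h4 := (measurePreserving_snd (μ := ν) (ν := ν)).quasiMeasurePreserving.ae_eq_comp hφ.coeFn_toLp
    have h5 := Lp.coeFn_sub (Lp.compMeasurePreserving Prod.fst (measurePreserving_fst (μ := ν) (ν := ν)) (hφ.toLp φ))
      (Lp.compMeasurePreserving Prod.snd (measurePreserving_snd (μ := ν) (ν := ν)) (hφ.toLp φ))
    filter_upwards [h1, h2, h3, h4, h5] with p h1 h2 h3 h4 h5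
    refine h5.trans ?_
    simp only [Pi.sub_apply, h1, h2, h3, h4]
    rfl
  have hr : MemLp (fun p : X × X => s p.1 p.2 - γ) ⊤ P := by
    refine memLp_top_of_bound (hs.sub_const γ).aestronglyMeasurable (R + |γ|) (Filter.Eventually.of_forall fun p => ?_)
    exact (norm_sub_le _ _).trans (add_le_add (hR _ _) le_rfl)
  let Rm : Lp ℝ 2 P →L[ℝ] Lp ℝ 2 P := (ContinuousLinearMap.mul ℝ ℝ).holderL P ⊤ 2 2 (hr.toLp _)
  have hRm : ∀ f : Lp ℝ 2 P, Rm f =ᵐ[P] fun p => (s p.1 p.2 - γ) * f p := by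
    intro f
    have h1 := (ContinuousLinearMap.mul ℝ ℝ).coeFn_holder (r := 2) (hr.toLp _) f
    filter_upwards [h1, hr.coeFn_toLp] with p h1 h2
    refine h1.trans ?_
    simp [h2]; ring
  let A : Lp ℝ 2 ν →L[ℝ] Lp ℝ 2 ν := γ • ContinuousLinearMap.id ℝ _ + (1/2 : ℝ) • (ContinuousLinearMap.adjoint D ∘L Rm ∘L D)
  have hA0 : ∀ a b, inner ℝ (A a) b = γ * inner ℝ a b + 1/2 * inner ℝ (Rm (D a)) (D b) := by
    intro a b
    simp [A, inner_add_left, inner_smul_left, ContinuousLinearMap.adjoint_inner_left]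
  have hA1 : ∀ a b, inner ℝ (Rm a) b = ∫ p, (s p.1 p.2 - γ) * (a p * b p) ∂P := by
    intro a b
    rw [L2.inner_def]
    apply integral_congr_ae
    filter_upwards [hRm a] with p hp
    simp [hp]; ring
  have hin : ∀ (φ κ : X → ℝ) (hφ : MemLp φ 2 ν) (hκ : MemLp κ 2 ν), 
      inner ℝ (hφ.toLp φ) (hκ.toLp κ) = ∫ x, φ x * κ x ∂ν := by
    intro φ κ hφ hκ
    rw [L2.inner_def]
    apply integral_congr_ae
    filter_upwards [hφ.coeFn_toLp, hκ.coeFn_toLp] with p hp hq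
    simp [hp, hq]; ring
  have hA2 : ∀ (φ κ : X → ℝ) (hφ : MemLp φ 2 ν) (hκ : MemLp κ 2 ν), 
      inner ℝ (A (hφ.toLp φ)) (hκ.toLp κ) = 
       - (∫ x, (∫ y, s x y * (φ y - φ x) ∂ν) * κ x ∂ν) + γ * ((∫ x, φ x ∂ν) * ∫ x, κ x ∂ν) := by
    intro φ κ hφ hκ
    rw [← (absKey ν s hs hsym γ R hR φ κ hφ hκ).2, hA0, hA1, hin]
    congr 2
    apply integral_congr_ae
    filter_upwards [hD φ hφ, hD κ hκ] with p hp hq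
    rw [hp, hq]
  have hcoer : ∀ a, γ * ‖a‖^2 ≤ inner ℝ (A a) a := by
    intro a
    rw [hA0, hA1, real_inner_self_eq_norm_sq]
    have : 0 ≤ ∫ p, (s p.1 p.2 - γ) * (D a p * D a p) ∂P :=
      integral_nonneg fun p => mul_nonneg (sub_nonneg.2 (hl _ _)) (mul_self_nonneg _)
    linarith
  have hU : IsUnit A := by
    apply ContinuousLinearMap.isUnit_of_forall_le_norm_inner_map A (c := ⟨γ, hγ.le⟩) hγ
    intro x
    refine le_trans ?_ (le_abs_self _)
    refine le_trans (le_of_eq ?_) (hcoer x)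
    rw [mul_comm]; rfl
  obtain ⟨φ, hφ⟩ : ∃ φ, A φ = - hg.toLp g := by
    obtain ⟨U, hU⟩ := hU
    refine ⟨(↑U⁻¹ : Lp ℝ 2 ν →L[ℝ] Lp ℝ 2 ν) (- hg.toLp g), ?_⟩
    rw [← hU, ← mul_apply_eq_comp]
    simp
  have hφL : MemLp φ 2 ν := Lp.memLp φ
  have hφt : hφL.toLp φ = φ := Lp.toLp_coeFn _ _
  have hsol : ∀ (κ : X → ℝ) (hκ : MemLp κ 2 ν), - (∫ x, (∫ y, s x y * (φ y - φ x) ∂ν) * κ x ∂ν) + γ * ((∫ x, φ x ∂ν) * ∫ x, κ x ∂ν) = - ∫ x, g x * κ x ∂ν := by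
    intro κ hκ
    rw [← hA2 φ κ hφL hκ, hφt, hφ, inner_neg_left, hin]
  have h1 : MemLp (fun _ : X => (1:ℝ)) 2 ν := memLp_const _
  have hm : ∫ x, φ x ∂ν = 0 := by
    have h2 := hsol _ h1
    have h3 := (absKey ν s hs hsym γ R hR φ _ hφL h1).2
    simp [hg0] at h2 h3
    have : γ * ∫ x, φ x ∂ν = 0 := by linarith
    rcases mul_eq_zero.1 this with h | h
    · exact absurd h hγ.ne'
    · exact h
  refine ⟨φ, (Lp.stronglyMeasurable φ).measurable, hφL, hm, ?_, ?_⟩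
  · intro κ hκ hκ0
    have := hsol κ hκ
    rw [hm] at this; linarith
  · intro φ' hφ' hm' H
    set d := hφ'.toLp φ' - φ with hd
    have hdL : MemLp d 2 ν := Lp.memLp d
    have hdt : hdL.toLp d = d := Lp.toLp_coeFn _ _
    have hde : d =ᵐ[ν] fun x => φ' x - φ x := by
      filter_upwards [Lp.coeFn_sub (hφ'.toLp φ') φ, hφ'.coeFn_toLp] with x h1 h2
      rw [hd, h1, Pi.sub_apply, h2]
    have hd0 : ∫ x, d x ∂ν = 0 := by
      rw [integral_congr_ae hde, integral_sub (hφ'.integrable (by norm_num)) (hφL.integrable (by norm_num)), hm, hm', sub_zero]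
    have q1 := H d (Lp.stronglyMeasurable d).measurable hdL hd0
    have q2 := hA2 φ' d hφ' hdL
    rw [q1, hm', hdt] at q2
    have q3 : inner ℝ (A φ) d = - ∫ x, g x * d x ∂ν := by
      rw [hφ, inner_neg_left, ← hin g d hg hdL, hdt]
    have q4 : inner ℝ (A d) d = 0 := by
      nth_rewrite 1 [hd]
      rw [map_sub, inner_sub_left, q2, q3]; ring
    have q5 := hcoer d
    rw [q4] at q5
    have q6 : ‖d‖ = 0 := by
      have : ‖d‖^2 ≤ 0 := by
        by_contra hc
        push Not at hc
        have := mul_pos hγ hc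
        linarith
      exact pow_eq_zero_iff (two_ne_zero) |>.1 (le_antisymm this (sq_nonneg _))
    have q7 : hφ'.toLp φ' = φ := sub_eq_zero.1 (norm_eq_zero.1 q6)
    exact (hφ'.coeFn_toLp).symm.trans (by rw [q7])
end abs

theorem kerInt {S SH : Set ℝ} (hS : MeasurableSet S)
    (k : ℝ → ℝ → ℝ)
    (hk : AEStronglyMeasurable (fun p : ℝ × ℝ => k p.1 p.2) ((volume.restrict S).prod (volume.restrict SH)))
    (hk0 : ∀ x y, 0 ≤ k x y)
    (a : ℝ → ℝ) (ha : Measurable a)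
    (h1 : ∀ x ∈ S, Integrable (k x) (volume.restrict SH))
    (h2 : Integrable (fun x => (∫ y in SH, k x y) * a x) (volume.restrict S)) :
    Integrable (fun p : ℝ × ℝ => k p.1 p.2 * a p.1) ((volume.restrict S).prod (volume.restrict SH)) := by
  have hm : AEStronglyMeasurable (fun p : ℝ × ℝ => k p.1 p.2 * a p.1)
      ((volume.restrict S).prod (volume.restrict SH)) :=
    hk.mul (ha.comp measurable_fst).aestronglyMeasurable
  rw [integrable_prod_iff hm]
  constructor
  · filter_upwards [ae_restrict_mem hS] with x hx
    exact (h1 x hx).mul_const _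
  · refine h2.norm.congr (Filter.Eventually.of_forall fun x => ?_)
    simp only [norm_mul, Real.norm_eq_abs]
    rw [integral_mul_const]
    congr 1
    rw [abs_of_nonneg (integral_nonneg fun y => hk0 x y)]
    congr 1; ext y; rw [abs_of_nonneg (hk0 x y)]

/-- Solvability lemma for the kinetic operator (Lemma 1): under Assumption A and the
continuity bound, for every mean-zero `g ∈ H` there is a unique (up to a.e. equality)
mean-zero weak solution `h ∈ H₀` of `G[h] = g`. -/
theorem stmt4 (n : ℕ) (hn : 1 ≤ n) (S SH : Set ℝ)
    (hS : MeasurableSet S) (hSH : MeasurableSet SH)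
    (η : ℝ → ℝ → ℝ) (hηmeas : Measurable (Function.uncurry η))
    (hηnn : ∀ u ustar, 0 ≤ η u ustar)
    (βk : ℝ → ℝ → ℝ → ℝ) (hβmeas : Measurable fun p : ℝ × ℝ × ℝ => βk p.1 p.2.1 p.2.2)
    (hβnn : ∀ u u' ustar, 0 ≤ βk u u' ustar)
    (fH : ℝ → ℝ) (hfHnn : ∀ ustar, 0 ≤ fH ustar) (hfHint : IntegrableOn fH SH)
    -- Assumption A
    (M : ℝ → ℝ) (hMmeas : Measurable M) (hMpos : ∀ u ∈ S, 0 < M u)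
    (hMnorm : (∫ _v, (∫ u in S, M u) ∂(sphMeasure n)) = 1)
    (hMmean : (∫ u in S, u * M u) = 0)
    (hdb : ∀ w ∈ S, ∀ u ∈ S,
      (∫ ustar in SH,
        (η w ustar * βk u w ustar * M w - η u ustar * βk w u ustar * M u) * fH ustar) = 0)
    (γ : ℝ) (hγ : 0 < γ)
    (hlb : ∀ w ∈ S, ∀ u ∈ S,
      γ * M u ≤ ∫ ustar in SH, η w ustar * βk u w ustar * fH ustar)
    -- continuity bound
    (C : ℝ) (hC : 0 < C)
    (hub : ∀ w ∈ S, ∀ u ∈ S,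
      (∫ ustar in SH, η u ustar * βk w u ustar * fH ustar) ≤ C * Real.sqrt (M u * M w))
    -- the datum g
    (g : Sph n → ℝ → ℝ) (hg : memH n S M g)
    (hgzero : (∫ v, (∫ u in S, g v u) ∂(sphMeasure n)) = 0) :
    ∃ h : Sph n → ℝ → ℝ,
      (memH0 n S M h ∧
        ∀ k : Sph n → ℝ → ℝ, memH0 n S M k →
          -(∫ v, (∫ u in S, Gop n S SH η βk fH h v u * (k v u / M u)) ∂(sphMeasure n)) =
            -(∫ v, (∫ u in S, g v u * (k v u / M u)) ∂(sphMeasure n))) ∧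
      ∀ h' : Sph n → ℝ → ℝ,
        (memH0 n S M h' ∧
          ∀ k : Sph n → ℝ → ℝ, memH0 n S M k →
            -(∫ v, (∫ u in S, Gop n S SH η βk fH h' v u * (k v u / M u)) ∂(sphMeasure n)) =
              -(∫ v, (∫ u in S, g v u * (k v u / M u)) ∂(sphMeasure n))) →
        (∀ᵐ p ∂((sphMeasure n).prod (volume.restrict S)), h' p.1 p.2 = h p.1 p.2) := by
  have : IsFiniteMeasure (sphMeasure n) := by unfold sphMeasure; infer_instance
  set σ := sphMeasure n with hσ
  set lS := (volume : Measure ℝ).restrict S with hlS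
  set μ := σ.prod lS with hμ
  -- M integrable
  have hMS : Integrable M lS := by
    by_contra hc
    rw [integral_undef hc] at hMnorm
    simp at hMnorm
  have hMμ : Integrable (fun p : Sph n × ℝ => M p.2) μ := hMS.comp_snd σ
  have hM1 : ∫ p : Sph n × ℝ, M p.2 ∂μ = 1 := by
    rw [hμ, integral_prod _ hMμ]; exact hMnorm
  have aeS : ∀ᵐ p : Sph n × ℝ ∂μ, p.2 ∈ S :=
    (quasiMeasurePreserving_snd (μ := σ) (ν := lS)).ae (ae_restrict_mem hS)
  set m : Sph n × ℝ → NNReal := fun p => Real.toNNReal (M p.2) with hm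
  have hmm : Measurable m := (hMmeas.comp measurable_snd).real_toNNReal
  have hmS : ∀ p : Sph n × ℝ, p.2 ∈ S → (m p : ℝ) = M p.2 := fun p hp =>
    Real.coe_toNNReal _ (hMpos _ hp).le
  set ν := μ.withDensity (fun p => (m p : ENNReal)) with hν
  have hprob : IsProbabilityMeasure ν := by
    constructor
    rw [hν, withDensity_apply _ MeasurableSet.univ, setLIntegral_univ]
    change ∫⁻ p, ENNReal.ofReal (M p.2) ∂μ = 1
    rw [← ofReal_integral_eq_lintegral_ofReal hMμ, hM1, ENNReal.ofReal_one]
    filter_upwards [aeS] with p hp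
    exact (hMpos _ hp).le
  have wI : ∀ f : Sph n × ℝ → ℝ, ∫ p, f p ∂ν = ∫ p, f p * M p.2 ∂μ := by
    intro f
    rw [hν, integral_withDensity_eq_integral_smul hmm]
    apply integral_congr_ae
    filter_upwards [aeS] with p hp
    rw [NNReal.smul_def, hmS p hp, smul_eq_mul, mul_comm]
  have wJ : ∀ f : Sph n × ℝ → ℝ, Integrable f ν ↔ Integrable (fun p => f p * M p.2) μ := by
    intro f
    rw [hν, integrable_withDensity_iff_integrable_coe_smul hmm]
    apply integrable_congr
    filter_upwards [aeS] with p hp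
    rw [hmS p hp, smul_eq_mul, mul_comm]
  -- the kernel
  set T : ℝ → ℝ → ℝ := fun u w => ∫ ustar in SH, η w ustar * βk u w ustar * fH ustar with hT
  have hfHm : AEMeasurable fH (volume.restrict SH) := hfHint.aemeasurable
  have hTint : ∀ u ∈ S, ∀ w ∈ S, Integrable (fun ustar => η w ustar * βk u w ustar * fH ustar) (volume.restrict SH) := by
    intro u hu w hw
    by_contra hc
    have h1 := hlb w hw u hu
    rw [integral_undef hc] at h1
    exact absurd h1 (not_le.2 (mul_pos hγ (hMpos u hu)))
  have hTsym : ∀ u ∈ S, ∀ w ∈ S, T u w * M w = T w u * M u := by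
    intro u hu w hw
    have h1 := hdb w hw u hu
    have h2 : ∀ x, (η w x * βk u w x * M w - η u x * βk w u x * M u) * fH x =
      (η w x * βk u w x * fH x) * M w - (η u x * βk w u x * fH x) * M u := fun x => by ring
    simp_rw [h2] at h1
    rw [integral_sub ((hTint u hu w hw).mul_const _) ((hTint w hw u hu).mul_const _),
      integral_mul_const, integral_mul_const] at h1
    exact sub_eq_zero.1 h1
  have hTmeas : Measurable (fun p : ℝ × ℝ => T p.1 p.2) := by
    have e : (fun p : ℝ × ℝ => T p.1 p.2) = fun p : ℝ × ℝ =>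
        ∫ ustar in SH, η p.2 ustar * βk p.1 p.2 ustar * hfHm.mk fH ustar := by
      ext p
      apply integral_congr_ae
      filter_upwards [hfHm.ae_eq_mk] with x hx
      rw [hx]
    rw [e]
    have h1 : Measurable (fun q : (ℝ × ℝ) × ℝ => η q.1.2 q.2 * βk q.1.1 q.1.2 q.2 * hfHm.mk fH q.2) := by
      refine Measurable.mul (Measurable.mul ?_ ?_) (hfHm.measurable_mk.comp measurable_snd)
      · exact hηmeas.comp (f := fun q : (ℝ × ℝ) × ℝ => (q.1.2, q.2)) (by fun_prop)
      · exact hβmeas.comp (f := fun q : (ℝ × ℝ) × ℝ => (q.1.1, q.1.2, q.2)) (by fun_prop)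
    exact (StronglyMeasurable.integral_prod_right h1.stronglyMeasurable).measurable
  have hTub : ∀ u ∈ S, ∀ w ∈ S, T u w ≤ C * Real.sqrt (M u * M w) := by
    intro u hu w hw
    have := hub u hu w hw
    rwa [mul_comm (M w)] at this
  have hTlb : ∀ u ∈ S, ∀ w ∈ S, γ * M u ≤ T u w := fun u hu w hw => hlb w hw u hu
  have hsq : ∀ u ∈ S, ∀ w ∈ S, γ * Real.sqrt (M u) ≤ C * Real.sqrt (M w) := by
    intro u hu w hw
    have h1 := (hTlb u hu w hw).trans (hTub u hu w hw)
    rw [Real.sqrt_mul (hMpos u hu).le] at h1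
    have h2 := Real.mul_self_sqrt (hMpos u hu).le
    have h3 := Real.sqrt_pos.2 (hMpos u hu)
    rw [← h2] at h1
    rw [Real.sqrt_mul_self h3.le] at h1
    refine le_of_mul_le_mul_left ?_ h3
    linarith
  have hTb : ∀ u ∈ S, ∀ w ∈ S, T u w / M u ≤ C * C / γ := by
    intro u hu w hw
    have h1 := hTub u hu w hw
    have h2 := hsq w hw u hu
    have h3 := Real.sqrt_pos.2 (hMpos u hu)
    have h4 := Real.mul_self_sqrt (hMpos u hu).le
    rw [Real.sqrt_mul (hMpos u hu).le] at h1
    rw [div_le_div_iff₀ (hMpos u hu) hγ]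
    calc T u w * γ ≤ (C * (Real.sqrt (M u) * Real.sqrt (M w))) * γ := by gcongr
      _ = C * Real.sqrt (M u) * (γ * Real.sqrt (M w)) := by ring
      _ ≤ C * Real.sqrt (M u) * (C * Real.sqrt (M u)) := by gcongr
      _ = C * C * (Real.sqrt (M u) * Real.sqrt (M u)) := by ring
      _ = C * C * M u := by rw [h4]
  classical
  set s : Sph n × ℝ → Sph n × ℝ → ℝ := fun x y =>
    if x.2 ∈ S ∧ y.2 ∈ S then T x.2 y.2 / M x.2 else γ with hs
  have hsS : ∀ x y : Sph n × ℝ, x.2 ∈ S → y.2 ∈ S → s x y = T x.2 y.2 / M x.2 :=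
    fun x y hx hy => if_pos ⟨hx, hy⟩
  have hsm : Measurable (Function.uncurry s) := by
    refine Measurable.ite ?_ ?_ measurable_const
    · exact ((measurable_snd.comp measurable_fst) hS).inter ((measurable_snd.comp measurable_snd) hS)
    · exact Measurable.div (hTmeas.comp (f := fun q : (Sph n × ℝ) × (Sph n × ℝ) => (q.1.2, q.2.2)) (by fun_prop))
        (hMmeas.comp (by fun_prop))
  have hssym : ∀ x y, s x y = s y x := by
    intro x y
    by_cases h : x.2 ∈ S ∧ y.2 ∈ S
    · rw [hsS x y h.1 h.2, hsS y x h.2 h.1, div_eq_div_iff (hMpos _ h.1).ne' (hMpos _ h.2).ne']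
      exact hTsym _ h.1 _ h.2
    · have h' : ¬ (y.2 ∈ S ∧ x.2 ∈ S) := fun q => h ⟨q.2, q.1⟩
      simp only [hs, if_neg h, if_neg h']
  have hsl : ∀ x y, γ ≤ s x y := by
    intro x y
    by_cases h : x.2 ∈ S ∧ y.2 ∈ S
    · rw [hsS x y h.1 h.2, le_div_iff₀ (hMpos _ h.1)]
      exact hTlb _ h.1 _ h.2
    · simp only [hs, if_neg h]; exact le_rfl
  have hsR : ∀ x y, |s x y| ≤ γ + C * C / γ := by
    intro x y
    rw [abs_of_nonneg (hγ.le.trans (hsl x y))]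
    by_cases h : x.2 ∈ S ∧ y.2 ∈ S
    · rw [hsS x y h.1 h.2]
      linarith [hTb _ h.1 _ h.2]
    · simp only [hs, if_neg h]
      have : 0 < C * C / γ := by positivity
      linarith
  -- from h to φ
  have relMem : ∀ (h : Sph n → ℝ → ℝ) (φ : Sph n × ℝ → ℝ), Measurable φ → Measurable (Function.uncurry h) →
      (∀ v, ∀ u ∈ S, h v u = φ (v, u) * M u) → (MemLp φ 2 ν ↔ memH n S M h) := by
    intro h φ hφ hh hr
    rw [memLp_two_iff_integrable_sq hφ.aestronglyMeasurable, wJ]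
    unfold memH
    rw [and_iff_right hh]
    apply integrable_congr
    filter_upwards [aeS] with p hp
    rw [hr p.1 p.2 hp]
    have := (hMpos _ hp).ne'
    field_simp
  have relInt : ∀ (h : Sph n → ℝ → ℝ) (φ : Sph n × ℝ → ℝ), Integrable φ ν →
      (∀ v, ∀ u ∈ S, h v u = φ (v, u) * M u) → 
      Integrable (fun p : Sph n × ℝ => h p.1 p.2) μ ∧ ∫ v, (∫ u in S, h v u) ∂σ = ∫ p, φ p ∂ν := by
    intro h φ hφ hr
    have e : (fun p : Sph n × ℝ => h p.1 p.2) =ᵐ[μ] fun p => φ p * M p.2 := by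
      filter_upwards [aeS] with p hp
      exact hr p.1 p.2 hp
    have hi : Integrable (fun p : Sph n × ℝ => h p.1 p.2) μ := ((wJ φ).1 hφ).congr e.symm
    refine ⟨hi, ?_⟩
    rw [wI, ← integral_congr_ae e]
    exact (integral_prod _ hi).symm
  have relG : ∀ (h : Sph n → ℝ → ℝ) (φ : Sph n × ℝ → ℝ), Measurable (Function.uncurry h) → Measurable φ →
      Integrable φ ν → (∀ v, ∀ u ∈ S, h v u = φ (v, u) * M u) → 
      ∀ v, ∀ u ∈ S, Gop n S SH η βk fH h v u = (∫ y, s (v, u) y * (φ y - φ (v, u)) ∂ν) * M u := by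
    intro h φ hh hφm hφ hr v u hu
    have hMu := (hMpos u hu).ne'
    have i1 : Integrable (fun y : Sph n × ℝ => T u y.2 * h y.1 y.2) μ := by
      have a1 : Integrable (fun y => s (v, u) y * φ y) ν :=
        hφ.bdd_mul (c := γ + C * C / γ) (hsm.comp measurable_prodMk_left).aestronglyMeasurable
          (Filter.Eventually.of_forall fun p => hsR _ p)
      refine (((wJ _).1 a1).mul_const (M u)).congr ?_
      filter_upwards [aeS] with y hy
      rw [hsS (v, u) y hu hy, hr y.1 y.2 hy]
      field_simp
    have i2 : Integrable (fun y : Sph n × ℝ => T y.2 u * h v u) μ := by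
      have a1 : Integrable (fun y => s (v, u) y * h v u) ν :=
        (integrable_const (h v u)).bdd_mul (c := γ + C * C / γ) (hsm.comp measurable_prodMk_left).aestronglyMeasurable
          (Filter.Eventually.of_forall fun p => hsR _ p)
      refine ((wJ _).1 a1).congr ?_
      filter_upwards [aeS] with y hy
      have := hTsym u hu y.2 hy
      rw [hsS (v, u) y hu hy]
      field_simp
      rw [mul_right_comm, this]; ring
    have e1 : (∫ y, s (v, u) y * (φ y - φ (v, u)) ∂ν) * M u = 
        ∫ y, (T u y.2 * h y.1 y.2 - T y.2 u * h v u) ∂μ := by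
      rw [wI, ← integral_mul_const]
      apply integral_congr_ae
      filter_upwards [aeS] with y hy
      have := hTsym u hu y.2 hy
      rw [hsS (v, u) y hu hy, hr y.1 y.2 hy, hr v u hu]
      field_simp
      linear_combination (-φ (v, u)) * this
    rw [e1]
    refine Eq.trans ?_ (integral_prod _ (i1.sub i2)).symm
    unfold Gop
    apply integral_congr_ae
    filter_upwards [i1.prod_right_ae, i2.prod_right_ae] with v' j1 j2
    have k1 : Integrable (fun p : ℝ × ℝ => (η p.1 p.2 * βk u p.1 p.2 * fH p.2) * h v' p.1)
        (lS.prod (volume.restrict SH)) := by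
      refine kerInt hS (fun w x => η w x * βk u w x * fH x) ?_ ?_ (h v') (hh.comp measurable_prodMk_left) ?_ j1
      · refine AEStronglyMeasurable.mul (Measurable.aestronglyMeasurable (Measurable.mul hηmeas ?_)) ?_
        · exact hβmeas.comp (f := fun q : ℝ × ℝ => (u, q.1, q.2)) (by fun_prop)
        · exact hfHint.aestronglyMeasurable.comp_snd
      · intro w x; exact mul_nonneg (mul_nonneg (hηnn _ _) (hβnn _ _ _)) (hfHnn _)
      · intro w hw; exact hTint u hu w hw
    have k2 : Integrable (fun p : ℝ × ℝ => (η u p.2 * βk p.1 u p.2 * fH p.2) * h v u)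
        (lS.prod (volume.restrict SH)) := by
      refine kerInt hS (fun w x => η u x * βk w u x * fH x) ?_ ?_ (fun _ => h v u) measurable_const ?_ j2
      · refine AEStronglyMeasurable.mul (Measurable.aestronglyMeasurable (Measurable.mul ?_ ?_)) ?_
        · exact hηmeas.comp (f := fun q : ℝ × ℝ => (u, q.2)) (by fun_prop)
        · exact hβmeas.comp (f := fun q : ℝ × ℝ => (q.1, u, q.2)) (by fun_prop)
        · exact hfHint.aestronglyMeasurable.comp_snd
      · intro w x; exact mul_nonneg (mul_nonneg (hηnn _ _) (hβnn _ _ _)) (hfHnn _)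
      · intro w hw; exact hTint w hw u hu
    have k3 : Integrable (Function.uncurry fun u' ustar =>
        (η u' ustar * βk u u' ustar * h v' u' - η u ustar * βk u' u ustar * h v u) * fH ustar)
        (lS.prod (volume.restrict SH)) := by
      refine (k1.sub k2).congr (Filter.Eventually.of_forall fun p => ?_)
      simp only [Pi.sub_apply, Function.uncurry]
      ring
    rw [← integral_integral_swap k3]
    apply integral_congr_ae
    filter_upwards [ae_restrict_mem hS] with w hw
    have l : ∀ x, (η w x * βk u w x * h v' w - η u x * βk w u x * h v u) * fH x =
      (η w x * βk u w x * fH x) * h v' w - (η u x * βk w u x * fH x) * h v u := fun x => by ring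
    simp_rw [l]
    rw [integral_sub ((hTint u hu w hw).mul_const _) ((hTint w hw u hu).mul_const _),
      integral_mul_const, integral_mul_const]
    rfl
  have relPair : ∀ (f : Sph n → ℝ → ℝ) (φ : Sph n × ℝ → ℝ) (k : Sph n → ℝ → ℝ) (κ : Sph n × ℝ → ℝ),
      (∀ v, ∀ u ∈ S, f v u = φ (v, u) * M u) → (∀ v, ∀ u ∈ S, k v u = κ (v, u) * M u) →
      Integrable (fun p => φ p * κ p) ν →
      ∫ v, (∫ u in S, f v u * (k v u / M u)) ∂σ = ∫ p, φ p * κ p ∂ν := by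
    intro f φ k κ hf hk hi
    refine (relInt (fun v u => f v u * (k v u / M u)) _ hi ?_).2
    intro v u hu
    have hMu := (hMpos u hu).ne'
    simp only [hf v u hu, hk v u hu]
    field_simp
  -- every h in H comes from some φ
  have relEx : ∀ h, memH n S M h → ∃ φ : Sph n × ℝ → ℝ, Measurable φ ∧ MemLp φ 2 ν ∧
      (∀ v, ∀ u ∈ S, h v u = φ (v, u) * M u) := by
    intro h hh
    have hφ : Measurable (fun p : Sph n × ℝ => h p.1 p.2 / M p.2) := hh.1.div (hMmeas.comp measurable_snd)
    have hr : ∀ v, ∀ u ∈ S, h v u = (fun p : Sph n × ℝ => h p.1 p.2 / M p.2) (v, u) * M u := by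
      intro v u hu
      exact (div_mul_cancel₀ _ (hMpos u hu).ne').symm
    exact ⟨_, hφ, (relMem h _ hφ hh.1 hr).2 hh, hr⟩
  have intL : ∀ φ : Sph n × ℝ → ℝ, MemLp φ 2 ν → Integrable φ ν := fun φ h => h.integrable (by norm_num)
  obtain ⟨g₀, hg₀m, hg₀, hg₀r⟩ := relEx g hg
  have hg₀0 : ∫ x, g₀ x ∂ν = 0 := by
    rw [← (relInt g g₀ (intL _ hg₀) hg₀r).2]; exact hgzero
  obtain ⟨φ, hφm, hφ, hφ0, hsol, huniq⟩ := absMain ν s hsm hssym γ _ hγ hsl hsR g₀ hg₀ hg₀0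
  -- weak formulation transfer
  have relW : ∀ (h : Sph n → ℝ → ℝ) (φ : Sph n × ℝ → ℝ) (k : Sph n → ℝ → ℝ) (κ : Sph n × ℝ → ℝ),
      Measurable (Function.uncurry h) → Measurable φ → MemLp φ 2 ν → MemLp κ 2 ν →
      (∀ v, ∀ u ∈ S, h v u = φ (v, u) * M u) → (∀ v, ∀ u ∈ S, k v u = κ (v, u) * M u) →
      ((∫ v, (∫ u in S, Gop n S SH η βk fH h v u * (k v u / M u)) ∂σ) =
        ∫ x, (∫ y, s x y * (φ y - φ x) ∂ν) * κ x ∂ν) ∧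
      (∫ v, (∫ u in S, g v u * (k v u / M u)) ∂σ) = ∫ x, g₀ x * κ x ∂ν := by
    intro h φ k κ hh hφm hφ hκ hr hk
    constructor
    · exact relPair _ (fun x => ∫ y, s x y * (φ y - φ x) ∂ν) k κ
        (relG h φ hh hφm (intL _ hφ) hr) hk (absKey ν s hsm hssym γ _ hsR φ κ hφ hκ).1
    · exact relPair _ _ k κ hg₀r hk (MemLp.integrable_mul hg₀ hκ)
  have hhm : Measurable (Function.uncurry fun v u => φ (v, u) * M u) :=
    hφm.mul (hMmeas.comp measurable_snd)
  refine ⟨fun v u => φ (v, u) * M u, ⟨⟨?_, ?_⟩, ?_⟩, ?_⟩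
  · exact (relMem _ φ hφm hhm (fun _ _ _ => rfl)).1 hφ
  · exact (relInt _ φ (intL _ hφ) (fun _ _ _ => rfl)).2.trans hφ0
  · intro k hk
    obtain ⟨κ, hκm, hκ, hκr⟩ := relEx k hk.1
    have hκ0 : ∫ x, κ x ∂ν = 0 := by
      rw [← (relInt k κ (intL _ hκ) hκr).2]; exact hk.2
    obtain ⟨w1, w2⟩ := relW _ φ k κ hhm hφm hφ hκ (fun _ _ _ => rfl) hκr
    rw [w1, w2, hsol κ hκ hκ0]
  · rintro h' ⟨hh', H⟩
    obtain ⟨φ', hφ'm, hφ', hφ'r⟩ := relEx h' hh'.1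
    have hφ'0 : ∫ x, φ' x ∂ν = 0 := by
      rw [← (relInt h' φ' (intL _ hφ') hφ'r).2]; exact hh'.2
    have q := huniq φ' hφ' hφ'0 (by
      intro κ hκm hκ hκ0
      have hkm : Measurable (Function.uncurry fun v u => κ (v, u) * M u) :=
        hκm.mul (hMmeas.comp measurable_snd)
      have H1 := H (fun v u => κ (v, u) * M u)
        ⟨(relMem _ κ hκm hkm (fun _ _ _ => rfl)).1 hκ,
          (relInt _ κ (intL _ hκ) (fun _ _ _ => rfl)).2.trans hκ0⟩
      obtain ⟨w1, w2⟩ := relW h' φ' (fun v u => κ (v, u) * M u) κ hh'.1.1 hφ'm hφ' hκ hφ'r (fun _ _ _ => rfl)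
      rw [w1, w2] at H1
      exact neg_injective H1)
    have q2 := (ae_withDensity_iff hmm.coe_nnreal_ennreal).1 q
    filter_upwards [q2, aeS] with p hp hpS
    have hne : (m p : ENNReal) ≠ 0 := by
      intro h0
      have h1 : m p = 0 := by exact_mod_cast h0
      have h2 := hmS p hpS
      rw [h1] at h2
      exact (hMpos _ hpS).ne' h2.symm
    rw [hφ'r p.1 p.2 hpS, hp hne]
end
end

section
/- Characterization of the kernel of the kinetic operator: under Assumption A, if h : V × Σ → ℝ is measurable with h integrable and h²/M integrable on V × Σ, the map (v̂, v̂', u, w, u_*) ↦ η(u,u_*) β(w; u,u_*) f_H(u_*) (h(v̂,u)²/M(u) + h(v̂',w)²/M(w)) is integrable on V × V × Σ × Σ × Σ_H, and G[h](v̂,u) = 0 for almost every (v̂,u) ∈ V × Σ, then h(v̂,u) = ρ · M(u) for almost every (v̂,u) ∈ V × Σ, where ρ = ∫_V ∫_Σ h(v̂,u) du dv̂; that is, the equilibria of the conservative operator are exactly the multiples of M. -/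
open MeasureTheory Measure

noncomputable section

lemma aux_abs {X : Type*} [MeasurableSpace X] (P : Measure X) [SFinite P]
    (J : X → X → ℝ) (H : X → ℝ)
    (hsym : ∀ᵐ p ∂(P.prod P), J p.1 p.2 = J p.2 p.1)
    (hpos : ∀ᵐ p ∂(P.prod P), 0 < J p.1 p.2)
    (hA : Integrable (fun p : X × X => J p.1 p.2 * H p.1 ^ 2) (P.prod P))
    (hB : Integrable (fun p : X × X => J p.1 p.2 * (H p.1 * H p.2)) (P.prod P))
    (h0 : ∫ p, (J p.1 p.2 * (H p.1 * H p.2) - J p.1 p.2 * H p.1 ^ 2) ∂(P.prod P) = 0) :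
    ∀ᵐ p ∂(P.prod P), H p.1 = H p.2 := by
  have hA2 : Integrable (fun p : X × X => J p.1 p.2 * H p.2 ^ 2) (P.prod P) := by
    refine hA.swap.congr ?_
    filter_upwards [hsym] with p hp
    simp [hp]
  have e2 : ∫ p, J p.1 p.2 * H p.2 ^ 2 ∂(P.prod P) = ∫ p, J p.1 p.2 * H p.1 ^ 2 ∂(P.prod P) := by
    rw [← integral_prod_swap]
    refine integral_congr_ae ?_
    filter_upwards [hsym] with p hp
    simp [hp]
  rw [integral_sub hB hA] at h0
  have h1 : ∫ p, J p.1 p.2 * (H p.1 - H p.2) ^ 2 ∂(P.prod P) = 0 := by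
    have : (fun p : X × X => J p.1 p.2 * (H p.1 - H p.2) ^ 2) =
      fun p => (J p.1 p.2 * H p.1 ^ 2 + J p.1 p.2 * H p.2 ^ 2)
        - 2 * (J p.1 p.2 * (H p.1 * H p.2)) := by
      ext p; ring
    rw [this, integral_sub (f := fun p : X × X => J p.1 p.2 * H p.1 ^ 2 + J p.1 p.2 * H p.2 ^ 2)
      (hA.add hA2) (hB.const_mul 2), integral_add hA hA2, integral_const_mul, e2]
    linarith
  have hI : Integrable (fun p : X × X => J p.1 p.2 * (H p.1 - H p.2) ^ 2) (P.prod P) := by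
    have : (fun p : X × X => J p.1 p.2 * (H p.1 - H p.2) ^ 2) =
      fun p => (J p.1 p.2 * H p.1 ^ 2 + J p.1 p.2 * H p.2 ^ 2)
        - 2 * (J p.1 p.2 * (H p.1 * H p.2)) := by
      ext p; ring
    rw [this]
    exact (hA.add hA2).sub (hB.const_mul 2)
  rw [integral_eq_zero_iff_of_nonneg_ae _ hI] at h1
  · filter_upwards [h1, hpos] with p hp hq
    have hp' : J p.1 p.2 * (H p.1 - H p.2) ^ 2 = 0 := hp
    rcases mul_eq_zero.1 hp' with h | h
    · exact absurd h hq.ne'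
    · exact sub_eq_zero.1 (pow_eq_zero_iff (two_ne_zero) |>.1 h)
  · filter_upwards [hpos] with p hq
    exact mul_nonneg hq.le (sq_nonneg _)

lemma aux_mp2 {V : Type*} [MeasurableSpace V] (μ : Measure V) (ν τ : Measure ℝ)
    [SFinite μ] [SFinite ν] [SFinite τ] :
    MeasurePreserving (fun q : ((V × ℝ) × (V × ℝ)) × ℝ =>
      ((q.1.1.1, q.1.2.1, q.1.1.2, q.1.2.2, q.2) : V × V × ℝ × ℝ × ℝ))
      (((μ.prod ν).prod (μ.prod ν)).prod τ)
      (μ.prod (μ.prod (ν.prod (ν.prod τ)))) := by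
  have a1 := measurePreserving_prodAssoc (μ.prod ν) (μ.prod ν) τ
  have a2 := (MeasurePreserving.id (μ.prod ν)).prod (measurePreserving_prodAssoc μ ν τ)
  have a3 := measurePreserving_prodAssoc μ ν (μ.prod (ν.prod τ))
  have b1 := (measurePreserving_prodAssoc ν μ (ν.prod τ)).symm
  have b2 := (measurePreserving_swap (μ := ν) (ν := μ)).prod (MeasurePreserving.id (ν.prod τ))
  have b3 := measurePreserving_prodAssoc μ ν (ν.prod τ)
  have a4 := (MeasurePreserving.id μ).prod (b3.comp (b2.comp b1))
  exact a4.comp (a3.comp (a2.comp a1))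

lemma aux_mp1 {X V : Type*} [MeasurableSpace X] [MeasurableSpace V] (P : Measure X)
    (μ : Measure V) (ν τ : Measure ℝ)
    [SFinite P] [SFinite μ] [SFinite ν] [SFinite τ] :
    MeasurePreserving (fun q : X × (V × (ℝ × ℝ)) =>
      (((q.1, (q.2.1, q.2.2.2)), q.2.2.1) : (X × (V × ℝ)) × ℝ))
      (P.prod (μ.prod (τ.prod ν)))
      ((P.prod (μ.prod ν)).prod τ) := by
  have a1 := (MeasurePreserving.id P).prod
    ((MeasurePreserving.id μ).prod (measurePreserving_swap (μ := τ) (ν := ν)))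
  have a2 := (MeasurePreserving.id P).prod (measurePreserving_prodAssoc μ ν τ).symm
  have a3 := (measurePreserving_prodAssoc P (μ.prod ν) τ).symm
  exact a3.comp (a2.comp a1)

lemma aux_fub {X V : Type*} [MeasurableSpace X] [MeasurableSpace V] (P : Measure X)
    (μ : Measure V) (ν τ : Measure ℝ)
    [SFinite P] [SFinite μ] [SFinite ν] [SFinite τ]
    (F : (X × (V × ℝ)) × ℝ → ℝ) (hF : Integrable F ((P.prod (μ.prod ν)).prod τ)) :
    ∫ q, F q ∂((P.prod (μ.prod ν)).prod τ) =
      ∫ x, ∫ v, ∫ s, ∫ u, F ((x, (v, u)), s) ∂ν ∂τ ∂μ ∂P := by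
  have mp := aux_mp1 P μ ν τ
  have hI : Integrable (fun q : X × (V × (ℝ × ℝ)) => F ((q.1, (q.2.1, q.2.2.2)), q.2.2.1))
      (P.prod (μ.prod (τ.prod ν))) := mp.integrable_comp_of_integrable hF
  have : ∫ q, F q ∂((P.prod (μ.prod ν)).prod τ) =
      ∫ q : X × (V × (ℝ × ℝ)), F ((q.1, (q.2.1, q.2.2.2)), q.2.2.1)
        ∂(P.prod (μ.prod (τ.prod ν))) := by
    rw [← mp.map_eq, integral_map mp.measurable.aemeasurable]
    rw [mp.map_eq]; exact hF.aestronglyMeasurable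
  rw [this, integral_prod _ hI]
  refine integral_congr_ae ?_
  filter_upwards [hI.prod_right_ae] with x hx
  rw [integral_prod _ hx]
  refine integral_congr_ae ?_
  filter_upwards [hx.prod_right_ae] with v hv
  exact integral_prod _ hv

/-- Characterization of the kernel of the kinetic operator: under Assumption A, if
`G[h] = 0` a.e. then `h(v̂,u) = ρ M(u)` a.e., where `ρ = ∫_V ∫_Σ h`. -/
theorem stmt5 (n : ℕ) (hn : 1 ≤ n) (S SH : Set ℝ)
    (hS : MeasurableSet S) (hSH : MeasurableSet SH)
    (η : ℝ → ℝ → ℝ) (hηmeas : Measurable (Function.uncurry η))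
    (hηnn : ∀ u ustar, 0 ≤ η u ustar)
    (βk : ℝ → ℝ → ℝ → ℝ) (hβmeas : Measurable fun p : ℝ × ℝ × ℝ => βk p.1 p.2.1 p.2.2)
    (hβnn : ∀ u u' ustar, 0 ≤ βk u u' ustar)
    (fH : ℝ → ℝ) (hfHnn : ∀ ustar, 0 ≤ fH ustar) (hfHint : IntegrableOn fH SH)
    -- Assumption A
    (M : ℝ → ℝ) (hMmeas : Measurable M) (hMpos : ∀ u ∈ S, 0 < M u)
    (hMnorm : (∫ _v, (∫ u in S, M u) ∂(sphMeasure n)) = 1)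
    (hMmean : (∫ u in S, u * M u) = 0)
    (hdb : ∀ w ∈ S, ∀ u ∈ S,
      (∫ ustar in SH,
        (η w ustar * βk u w ustar * M w - η u ustar * βk w u ustar * M u) * fH ustar) = 0)
    (γ : ℝ) (hγ : 0 < γ)
    (hlb : ∀ w ∈ S, ∀ u ∈ S,
      γ * M u ≤ ∫ ustar in SH, η w ustar * βk u w ustar * fH ustar)
    -- the function h and its integrability
    (h : Sph n → ℝ → ℝ) (hhmeas : Measurable (Function.uncurry h))
    (hhint : Integrable (fun p : Sph n × ℝ => h p.1 p.2)
      ((sphMeasure n).prod (volume.restrict S)))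
    (hsq : Integrable (fun p : Sph n × ℝ => h p.1 p.2 ^ 2 / M p.2)
      ((sphMeasure n).prod (volume.restrict S)))
    (hint : Integrable
      (fun p : Sph n × Sph n × ℝ × ℝ × ℝ =>
        η p.2.2.1 p.2.2.2.2 * βk p.2.2.2.1 p.2.2.1 p.2.2.2.2 * fH p.2.2.2.2 *
          (h p.1 p.2.2.1 ^ 2 / M p.2.2.1 + h p.2.1 p.2.2.2.1 ^ 2 / M p.2.2.2.1))
      ((sphMeasure n).prod ((sphMeasure n).prod
        ((volume.restrict S).prod ((volume.restrict S).prod (volume.restrict SH))))))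
    -- kernel hypothesis
    (hker : ∀ᵐ p ∂((sphMeasure n).prod (volume.restrict S)),
      Gop n S SH η βk fH h p.1 p.2 = 0) :
    ∀ᵐ p ∂((sphMeasure n).prod (volume.restrict S)),
      h p.1 p.2 = (∫ v, (∫ u in S, h v u) ∂(sphMeasure n)) * M p.2 := by
  have : IsFiniteMeasure (sphMeasure n) := by unfold sphMeasure; infer_instance
  set μ := sphMeasure n with hμ
  set ν : Measure ℝ := volume.restrict S with hν
  set τ : Measure ℝ := volume.restrict SH with hτ
  set P := μ.prod ν with hP
  have iν : SFinite ν := by rw [hν]; infer_instance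
  have iτ : SFinite τ := by rw [hτ]; infer_instance
  have iP : SFinite P := by rw [hP]; infer_instance
  have iPP : SFinite (P.prod P) := inferInstance
  set k : ℝ → ℝ → ℝ → ℝ := fun w u s => η w s * βk u w s * fH s with hk
  have hknn : ∀ w u s, 0 ≤ k w u s := fun w u s =>
    mul_nonneg (mul_nonneg (hηnn _ _) (hβnn _ _ _)) (hfHnn _)
  set K : ℝ → ℝ → ℝ := fun w u => ∫ s, k w u s ∂τ with hK
  set H : Sph n × ℝ → ℝ := fun x => h x.1 x.2 / M x.2 with hH
  set J : Sph n × ℝ → Sph n × ℝ → ℝ := fun x y => K x.2 y.2 * M x.2 with hJ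
  have hKpos : ∀ w ∈ S, ∀ u ∈ S, 0 < K w u := fun w hw u hu =>
    lt_of_lt_of_le (mul_pos hγ (hMpos u hu)) (hlb w hw u hu)
  have hkint : ∀ w ∈ S, ∀ u ∈ S, Integrable (k w u) τ := fun w hw u hu => by
    by_contra hc
    have := hKpos w hw u hu
    simp only [hK] at this
    rw [integral_undef hc] at this
    exact lt_irrefl _ this
  have hKsym : ∀ w ∈ S, ∀ u ∈ S, K w u * M w = K u w * M u := fun w hw u hu => by
    have h1 := hdb w hw u hu
    have h2 : (∫ s, (η w s * βk u w s * M w - η u s * βk w u s * M u) * fH s ∂τ)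
        = ∫ s, (k w u s * M w - k u w s * M u) ∂τ := by
      refine integral_congr_ae (Filter.Eventually.of_forall fun s => ?_)
      simp only [hk]; ring
    rw [h2, integral_sub ((hkint w hw u hu).mul_const _) ((hkint u hu w hw).mul_const _),
      integral_mul_const, integral_mul_const] at h1
    linarith
  have hSP : ∀ᵐ x ∂P, x.2 ∈ S :=
    (quasiMeasurePreserving_snd (μ := μ) (ν := ν)).ae (ae_restrict_mem hS)
  have hSPP : ∀ᵐ p ∂(P.prod P), p.1.2 ∈ S ∧ p.2.2 ∈ S := by
    filter_upwards [(quasiMeasurePreserving_fst (μ := P) (ν := P)).ae hSP,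
      (quasiMeasurePreserving_snd (μ := P) (ν := P)).ae hSP] with p h1 h2
    exact ⟨h1, h2⟩
  have hSPT : ∀ᵐ q ∂((P.prod P).prod τ), q.1.1.2 ∈ S ∧ q.1.2.2 ∈ S :=
    (quasiMeasurePreserving_fst (μ := P.prod P) (ν := τ)).ae hSPP
  -- measurability
  have hkm : AEStronglyMeasurable
      (fun q : ((Sph n × ℝ) × (Sph n × ℝ)) × ℝ => k q.1.1.2 q.1.2.2 q.2) ((P.prod P).prod τ) := by
    have m1 : Measurable (fun q : ((Sph n × ℝ) × (Sph n × ℝ)) × ℝ => η q.1.1.2 q.2) :=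
      hηmeas.comp (f := fun q : ((Sph n × ℝ) × (Sph n × ℝ)) × ℝ => (q.1.1.2, q.2)) (by fun_prop)
    have m2 : Measurable (fun q : ((Sph n × ℝ) × (Sph n × ℝ)) × ℝ => βk q.1.2.2 q.1.1.2 q.2) :=
      hβmeas.comp (f := fun q : ((Sph n × ℝ) × (Sph n × ℝ)) × ℝ => (q.1.2.2, q.1.1.2, q.2))
        (by fun_prop)
    have m3 : AEStronglyMeasurable (fun q : ((Sph n × ℝ) × (Sph n × ℝ)) × ℝ => fH q.2)
        ((P.prod P).prod τ) := AEStronglyMeasurable.comp_snd hfHint.aestronglyMeasurable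
    exact (m1.mul m2).aestronglyMeasurable.mul m3
  have hkm' : AEStronglyMeasurable
      (fun q : ((Sph n × ℝ) × (Sph n × ℝ)) × ℝ => k q.1.2.2 q.1.1.2 q.2) ((P.prod P).prod τ) := by
    have mp := (measurePreserving_swap (μ := P) (ν := P)).prod (MeasurePreserving.id τ)
    exact hkm.comp_measurePreserving mp
  have hhm : Measurable (fun x : Sph n × ℝ => h x.1 x.2) := hhmeas
  have hHm : Measurable H := hhm.div (hMmeas.comp measurable_snd)
  have hJm : AEStronglyMeasurable (fun p : (Sph n × ℝ) × (Sph n × ℝ) => J p.1 p.2)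
      (P.prod P) := by
    refine (hkm.integral_prod_right').mul ?_
    exact (hMmeas.comp (measurable_snd.comp measurable_fst)).aestronglyMeasurable
  -- term 2
  have hT2 : Integrable (fun q : ((Sph n × ℝ) × (Sph n × ℝ)) × ℝ =>
      k q.1.1.2 q.1.2.2 q.2 * (h q.1.1.1 q.1.1.2 * H q.1.1)) ((P.prod P).prod τ) := by
    have h1 := (aux_mp2 μ ν τ).integrable_comp_of_integrable hint
    refine h1.mono (hkm.mul ?_) ?_
    · exact ((hhm.mul hHm).comp (measurable_fst.comp measurable_fst)).aestronglyMeasurable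
    · filter_upwards [hSPT] with q hq
      have p1 := hMpos _ hq.1
      have p2 := hMpos _ hq.2
      have e1 : h q.1.1.1 q.1.1.2 * H q.1.1 = h q.1.1.1 q.1.1.2 ^ 2 / M q.1.1.2 := by
        simp only [hH]; ring
      have n0 := hknn q.1.1.2 q.1.2.2 q.2
      have n1 : 0 ≤ h q.1.1.1 q.1.1.2 ^ 2 / M q.1.1.2 := by positivity
      have n2 : 0 ≤ h q.1.2.1 q.1.2.2 ^ 2 / M q.1.2.2 := by positivity
      rw [e1, Real.norm_of_nonneg (mul_nonneg n0 n1)]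
      refine le_trans ?_ (le_abs_self _)
      exact mul_le_mul_of_nonneg_left (le_add_of_nonneg_right n2) n0
  have hA : Integrable (fun p : (Sph n × ℝ) × (Sph n × ℝ) => J p.1 p.2 * H p.1 ^ 2)
      (P.prod P) := by
    refine hT2.integral_prod_left.congr ?_
    filter_upwards [hSPP] with p hp
    have p1 := hMpos _ hp.1
    rw [integral_mul_const]
    simp only [hJ, hK, hH]
    field_simp
  have hsym : ∀ᵐ p ∂(P.prod P), J p.1 p.2 = J p.2 p.1 := by
    filter_upwards [hSPP] with p hp
    exact hKsym _ hp.1 _ hp.2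
  have hJpos : ∀ᵐ p ∂(P.prod P), 0 < J p.1 p.2 := by
    filter_upwards [hSPP] with p hp
    exact mul_pos (hKpos _ hp.1 _ hp.2) (hMpos _ hp.1)
  have hB : Integrable (fun p : (Sph n × ℝ) × (Sph n × ℝ) => J p.1 p.2 * (H p.1 * H p.2))
      (P.prod P) := by
    refine (hA.add hA.swap).mono (hJm.mul ?_) ?_
    · exact ((hHm.comp measurable_fst).mul (hHm.comp measurable_snd)).aestronglyMeasurable
    · filter_upwards [hsym, hJpos] with p hp hp0
      refine le_trans ?_ (le_abs_self _)
      simp only [Pi.add_apply, Function.comp, Prod.fst_swap, Prod.snd_swap]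
      rw [← hp, Real.norm_eq_abs, abs_mul, abs_of_pos hp0, ← mul_add]
      refine mul_le_mul_of_nonneg_left ?_ hp0.le
      rw [abs_le]
      constructor <;> nlinarith [sq_nonneg (H p.1 - H p.2), sq_nonneg (H p.1 + H p.2),
        sq_nonneg (H p.1), sq_nonneg (H p.2)]
  have hT1 : Integrable (fun q : ((Sph n × ℝ) × (Sph n × ℝ)) × ℝ =>
      k q.1.2.2 q.1.1.2 q.2 * (H q.1.1 * h q.1.2.1 q.1.2.2)) ((P.prod P).prod τ) := by
    have hm := hkm'.mul (((hHm.comp measurable_fst).mul (hhm.comp measurable_snd)).comp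
      (measurable_fst (α := (Sph n × ℝ) × (Sph n × ℝ)) (β := ℝ))).aestronglyMeasurable
    refine (integrable_prod_iff hm).2 ⟨?_, ?_⟩
    · filter_upwards [hSPP] with p hp
      exact (hkint _ hp.2 _ hp.1).mul_const (H p.1 * h p.2.1 p.2.2)
    · refine hB.norm.congr ?_
      filter_upwards [hSPP, hsym, hJpos] with p hp hs hj
      have p2 := hMpos _ hp.2
      simp only [Pi.mul_apply, Function.comp, norm_mul]
      rw [integral_mul_const]
      have : ∫ s, ‖k p.2.2 p.1.2 s‖ ∂τ = K p.2.2 p.1.2 := by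
        simp only [hK]
        exact integral_congr_ae (Filter.Eventually.of_forall fun s =>
          Real.norm_of_nonneg (hknn _ _ _))
      rw [this, hs]
      simp only [hJ, norm_mul]
      rw [Real.norm_of_nonneg (hKpos _ hp.2 _ hp.1).le]
      have : ‖h p.2.1 p.2.2‖ = ‖M p.2.2‖ * ‖H p.2‖ := by
        rw [← norm_mul]; congr 1; simp only [hH]; field_simp
      rw [this]; ring
  have hF0 := aux_fub P μ ν τ _ (hT1.sub hT2)
  have hz : (∫ x, ∫ v, ∫ s, ∫ u, (k u x.2 s * (H x * h v u)
      - k x.2 u s * (h x.1 x.2 * H x)) ∂ν ∂τ ∂μ ∂P) = 0 := by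
    rw [integral_eq_zero_of_ae]
    filter_upwards [hker] with x hx
    have : H x * Gop n S SH η βk fH h x.1 x.2 = 0 := by rw [hx, mul_zero]
    simp only [Gop, ← integral_const_mul] at this
    refine Eq.trans ?_ this
    refine integral_congr_ae (Filter.Eventually.of_forall fun v => ?_)
    refine integral_congr_ae (Filter.Eventually.of_forall fun s => ?_)
    refine integral_congr_ae (Filter.Eventually.of_forall fun u => ?_)
    simp only [hk]; ring
  have hFz := hF0.trans hz
  rw [integral_prod _ (hT1.sub hT2)] at hFz
  have h0 : ∫ p, (J p.1 p.2 * (H p.1 * H p.2) - J p.1 p.2 * H p.1 ^ 2) ∂(P.prod P) = 0 := by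
    rw [← hFz]
    refine integral_congr_ae ?_
    filter_upwards [hSPP, hsym] with p hp hs
    have p1 := hMpos _ hp.1
    have p2 := hMpos _ hp.2
    simp only [Pi.sub_apply]
    rw [integral_sub ((hkint _ hp.2 _ hp.1).mul_const _) ((hkint _ hp.1 _ hp.2).mul_const _),
      integral_mul_const, integral_mul_const]
    change _ = K p.2.2 p.1.2 * _ - K p.1.2 p.2.2 * _
    have e2 : h p.2.1 p.2.2 = M p.2.2 * H p.2 := by
      simp only [hH]; field_simp
    have e1 : h p.1.1 p.1.2 = M p.1.2 * H p.1 := by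
      simp only [hH]; field_simp
    rw [e1, e2]
    nth_rewrite 1 [hs]
    simp only [hJ]; ring
  have hfin := aux_abs P J H hsym hJpos hA hB h0
  have hMint : Integrable M ν := by
    by_contra hc
    rw [integral_undef hc] at hMnorm
    simp at hMnorm
  have hM1 : ∫ y, M y.2 ∂P = 1 := by
    rw [← hMnorm]
    exact integral_prod _ (hMint.comp_snd μ)
  have hrho : (∫ v, (∫ u, h v u ∂ν) ∂μ) = ∫ y, h y.1 y.2 ∂P := (integral_prod _ hhint).symm
  rw [hrho]
  filter_upwards [ae_ae_of_ae_prod hfin, hSP] with x hx hxS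
  have p1 := hMpos _ hxS
  have : ∫ y, h y.1 y.2 ∂P = ∫ y, H x * M y.2 ∂P := by
    refine integral_congr_ae ?_
    filter_upwards [hx, hSP] with y hy hyS
    have p2 := hMpos _ hyS
    rw [hy]; simp only [hH]; field_simp
  rw [this, integral_const_mul, hM1]
  simp only [hH]; field_simp
end
end

section
/- Explicit Jacobian of the reaction kinetics at the steady state: assume ζ > 1, τ > 0 and β > ν > 0, and let (n̄₁, n̄₂) = (β τ/((ζ−1)(β−ν)), τ/(β−ν)). Then the partial derivatives of F₁ and F₂ at (n̄₁, n̄₂) are ∂F₁/∂n₁ = τ(ζ−1)/(ζ(β−ν)), ∂F₁/∂n₂ = −β τ/(ζ(β−ν)), ∂F₂/∂n₁ = τ(ζ−1)²/(ζ(β−ν)), and ∂F₂/∂n₂ = τ(β−ζν)/(ζ(β−ν)). -/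
noncomputable section

/-- The first reaction function of the macroscopic leaf-surface model. -/
noncomputable def F1 (ζ β : ℝ) (x y : ℝ) : ℝ := ζ * x ^ 2 * y / (x + β * y) - x * y

/-- The second reaction function of the macroscopic leaf-surface model. -/
noncomputable def F2 (ζ β τ ν : ℝ) (x y : ℝ) : ℝ :=
  ζ * β * x * y ^ 2 / (x + β * y) - τ * y - ν * y ^ 2

/-- Explicit Jacobian of the reaction kinetics at the steady state
`(n̄₁, n̄₂) = (βτ/((ζ−1)(β−ν)), τ/(β−ν))`: the four partial derivatives of `F₁`, `F₂`
at `(n̄₁, n̄₂)` are as stated. -/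
theorem stmt10 (ζ β τ ν : ℝ) (hζ : 1 < ζ) (hτ : 0 < τ) (hν : 0 < ν) (hβν : ν < β) :
    HasDerivAt (fun x => F1 ζ β x (τ / (β - ν)))
      (τ * (ζ - 1) / (ζ * (β - ν))) (β * τ / ((ζ - 1) * (β - ν))) ∧
    HasDerivAt (fun y => F1 ζ β (β * τ / ((ζ - 1) * (β - ν))) y)
      (-(β * τ) / (ζ * (β - ν))) (τ / (β - ν)) ∧
    HasDerivAt (fun x => F2 ζ β τ ν x (τ / (β - ν)))
      (τ * (ζ - 1) ^ 2 / (ζ * (β - ν))) (β * τ / ((ζ - 1) * (β - ν))) ∧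
    HasDerivAt (fun y => F2 ζ β τ ν (β * τ / ((ζ - 1) * (β - ν))) y)
      (τ * (β - ζ * ν) / (ζ * (β - ν))) (τ / (β - ν)) := by
  have hz1 : ζ - 1 ≠ 0 := by linarith
  have hz : ζ ≠ 0 := by linarith
  have hc : β - ν ≠ 0 := by linarith
  have hb : β ≠ 0 := by linarith
  have ht : τ ≠ 0 := hτ.ne'
  have hD : β * τ / ((ζ - 1) * (β - ν)) + β * (τ / (β - ν))
      = ζ * β * τ / ((ζ - 1) * (β - ν)) := by
    field_simp
    ring
  have hD0 : β * τ / ((ζ - 1) * (β - ν)) + β * (τ / (β - ν)) ≠ 0 := by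
    rw [hD]
    positivity
  unfold F1 F2
  refine ⟨?_, ?_, ?_, ?_⟩
  · have h := ((((hasDerivAt_id' (β * τ / ((ζ - 1) * (β - ν)))).pow 2).const_mul ζ).mul_const
      (τ / (β - ν))).fun_div ((hasDerivAt_id' (β * τ / ((ζ - 1) * (β - ν)))).add_const
        (β * (τ / (β - ν)))) hD0
    have h2 := h.fun_sub ((hasDerivAt_id' (β * τ / ((ζ - 1) * (β - ν)))).mul_const (τ / (β - ν)))
    refine h2.congr_deriv ?_
    simp only [Pi.pow_apply, Nat.cast_ofNat, Nat.add_one_sub_one, Nat.reduceSub, pow_one]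
    rw [hD]
    field_simp
    ring
  · have h := ((hasDerivAt_id' (τ / (β - ν))).const_mul
      (ζ * (β * τ / ((ζ - 1) * (β - ν))) ^ 2)).fun_div
        (((hasDerivAt_id' (τ / (β - ν))).const_mul β).const_add
          (β * τ / ((ζ - 1) * (β - ν)))) hD0
    have h2 := h.fun_sub ((hasDerivAt_id' (τ / (β - ν))).const_mul (β * τ / ((ζ - 1) * (β - ν))))
    refine h2.congr_deriv ?_
    rw [hD]
    field_simp
    ring
  · have h := (((hasDerivAt_id' (β * τ / ((ζ - 1) * (β - ν)))).const_mul (ζ * β)).mul_const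
      ((τ / (β - ν)) ^ 2)).fun_div ((hasDerivAt_id' (β * τ / ((ζ - 1) * (β - ν)))).add_const
        (β * (τ / (β - ν)))) hD0
    have h2 := (h.sub_const (τ * (τ / (β - ν)))).sub_const (ν * (τ / (β - ν)) ^ 2)
    refine h2.congr_deriv ?_
    rw [hD]
    field_simp
  · have h := (((hasDerivAt_id' (τ / (β - ν))).pow 2).const_mul
      (ζ * β * (β * τ / ((ζ - 1) * (β - ν))))).fun_div
        (((hasDerivAt_id' (τ / (β - ν))).const_mul β).const_add
          (β * τ / ((ζ - 1) * (β - ν)))) hD0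
    have h2 := (h.fun_sub ((hasDerivAt_id' (τ / (β - ν))).const_mul τ)).fun_sub
      (((hasDerivAt_id' (τ / (β - ν))).pow 2).const_mul ν)
    refine h2.congr_deriv ?_
    simp only [Pi.pow_apply, Nat.cast_ofNat, Nat.add_one_sub_one, Nat.reduceSub, pow_one]
    rw [hD]
    field_simp
    ring
end
end

section
/- Linear stability of the homogeneous steady state: assume τ > 0, ν > 1, β > ν and ζ > (β−1)/(ν−1) (note these imply ζ > 1). Then the Jacobian matrix J satisfies trace(J) = τ(β − 1 + ζ(1−ν))/(ζ(β−ν)) < 0 and det(J) = τ²(ζ−1)/(ζ(β−ν)) > 0; consequently, every complex root z of the characteristic polynomial z² − trace(J) z + det(J) has strictly negative real part. -/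
noncomputable section

/-- The Jacobian matrix of the macroscopic leaf-surface model at its homogeneous
steady state. -/
noncomputable def Jmat (ζ β τ ν : ℝ) : Matrix (Fin 2) (Fin 2) ℝ :=
  !![τ * (ζ - 1) / (ζ * (β - ν)), -(β * τ) / (ζ * (β - ν));
     τ * (ζ - 1) ^ 2 / (ζ * (β - ν)), τ * (β - ζ * ν) / (ζ * (β - ν))]

/-- Linear stability of the homogeneous steady state: under the stated parameter
conditions, `trace J < 0` and `det J > 0`, hence every complex root of the
characteristic polynomial `z² − trace(J) z + det(J)` has strictly negative real part. -/
theorem stmt11 (ζ β τ ν : ℝ) (hτ : 0 < τ) (hν : 1 < ν) (hβν : ν < β)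
    (hζ : (β - 1) / (ν - 1) < ζ) :
    Matrix.trace (Jmat ζ β τ ν) = τ * (β - 1 + ζ * (1 - ν)) / (ζ * (β - ν)) ∧
    Matrix.trace (Jmat ζ β τ ν) < 0 ∧
    Matrix.det (Jmat ζ β τ ν) = τ ^ 2 * (ζ - 1) / (ζ * (β - ν)) ∧
    0 < Matrix.det (Jmat ζ β τ ν) ∧
    ∀ z : ℂ, z ^ 2 - (Matrix.trace (Jmat ζ β τ ν) : ℝ) * z
        + (Matrix.det (Jmat ζ β τ ν) : ℝ) = 0 → z.re < 0 := by
  have hν1 : 0 < ν - 1 := by linarith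
  have hb : 0 < β - ν := by linarith
  have h1 : β - 1 < ζ * (ν - 1) := (div_lt_iff₀ hν1).mp hζ
  have hz1 : 1 < ζ := by
    have : 1 < (β - 1) / (ν - 1) := by rw [lt_div_iff₀ hν1]; linarith
    linarith
  have hz0 : 0 < ζ := by linarith
  have hden : 0 < ζ * (β - ν) := mul_pos hz0 hb
  have hT : Matrix.trace (Jmat ζ β τ ν) = τ * (β - 1 + ζ * (1 - ν)) / (ζ * (β - ν)) := by
    simp only [Jmat, Matrix.trace_fin_two_of]
    rw [← add_div]
    congr 1
    ring
  have hD : Matrix.det (Jmat ζ β τ ν) = τ ^ 2 * (ζ - 1) / (ζ * (β - ν)) := by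
    simp only [Jmat, Matrix.det_fin_two_of]
    have h2 := hz0.ne'
    have h3 := hb.ne'
    field_simp
    ring
  have hTn : Matrix.trace (Jmat ζ β τ ν) < 0 := by
    rw [hT]
    exact div_neg_of_neg_of_pos (mul_neg_of_pos_of_neg hτ (by linarith)) hden
  have hDp : 0 < Matrix.det (Jmat ζ β τ ν) := by
    rw [hD]
    exact div_pos (mul_pos (pow_pos hτ 2) (by linarith)) hden
  refine ⟨hT, hTn, hD, hDp, ?_⟩
  generalize Matrix.trace (Jmat ζ β τ ν) = T at *
  generalize Matrix.det (Jmat ζ β τ ν) = D at *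
  intro z hz
  by_contra hx
  have hx : 0 ≤ z.re := not_lt.mp hx
  have hre := congrArg Complex.re hz
  have him := congrArg Complex.im hz
  simp [pow_two] at hre him
  have hy : z.im * (2 * z.re - T) = 0 := by linarith
  have hy0 : z.im = 0 := by
    rcases mul_eq_zero.mp hy with h | h
    · exact h
    · linarith
  rw [hy0] at hre
  nlinarith [mul_nonneg hx hx, mul_nonneg hx (neg_pos.mpr hTn).le]
end
end

section
/- Hopf bifurcation condition: assume τ > 0, β > ν > 1 and ζ = (β−1)/(ν−1). Then the Jacobian matrix J satisfies trace(J) = 0 and det(J) > 0; consequently, every complex root z of the characteristic polynomial z² − trace(J) z + det(J) is purely imaginary and nonzero (z.re = 0 and z ≠ 0), i.e. J has a pair of purely imaginary eigenvalues. -/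
noncomputable section

/-- Hopf bifurcation condition: if `τ > 0`, `β > ν > 1` and `ζ = (β−1)/(ν−1)`, then
`trace J = 0` and `det J > 0`, hence every complex root of the characteristic
polynomial `z² − trace(J) z + det(J)` is purely imaginary and nonzero. -/
theorem stmt12 (ζ β τ ν : ℝ) (hτ : 0 < τ) (hν : 1 < ν) (hβν : ν < β)
    (hζ : ζ = (β - 1) / (ν - 1)) :
    Matrix.trace (Jmat ζ β τ ν) = 0 ∧
    0 < Matrix.det (Jmat ζ β τ ν) ∧
    ∀ z : ℂ, z ^ 2 - (Matrix.trace (Jmat ζ β τ ν) : ℝ) * z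
        + (Matrix.det (Jmat ζ β τ ν) : ℝ) = 0 → z.re = 0 ∧ z ≠ 0 := by
  have h1 : 0 < ν - 1 := by linarith
  have hz : 1 < ζ := by rw [hζ, lt_div_iff₀ h1]; linarith
  have hz1 : 0 < ζ - 1 := by linarith
  have hz0 : 0 < ζ := by linarith
  have hb : 0 < β - ν := by linarith
  have he : ζ * (ν - 1) = β - 1 := by rw [hζ]; field_simp
  have ht : Matrix.trace (Jmat ζ β τ ν) = 0 := by
    simp only [Jmat, Matrix.trace_fin_two_of]
    rw [← add_div, div_eq_zero_iff]
    left
    linear_combination (-τ) * he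
  have hd : Matrix.det (Jmat ζ β τ ν) = τ ^ 2 * (ζ - 1) / (ζ * (β - ν)) := by
    simp only [Jmat, Matrix.det_fin_two_of]
    have := hz0.ne'
    have := hb.ne'
    field_simp
    ring
  have hp : 0 < Matrix.det (Jmat ζ β τ ν) := by rw [hd]; positivity
  refine ⟨ht, hp, ?_⟩
  intro z h
  rw [ht] at h
  generalize Matrix.det (Jmat ζ β τ ν) = d at h hp
  have hre := congrArg Complex.re h
  have him := congrArg Complex.im h
  simp [pow_two] at hre him
  constructor
  · by_contra hne
    have hi : z.im = 0 := by
      have : z.re * z.im = 0 := by linarith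
      exact (mul_eq_zero.mp this).resolve_left hne
    rw [hi] at hre
    nlinarith [mul_self_nonneg z.re]
  · rintro rfl
    simp at hre
    linarith
end
end

section
/- Activator–inhibitor sign pattern of the Jacobian: assume τ > 0, ν > 1, β > ν and ζ > (β−1)/(ν−1). Then the Jacobian matrix J has sign pattern J₁₁ > 0, J₁₂ < 0, J₂₁ > 0 and J₂₂ < 0 (in particular β < ζν). -/
noncomputable section

/-- Activator–inhibitor sign pattern of the Jacobian: under the stated parameter
conditions, `J₁₁ > 0`, `J₁₂ < 0`, `J₂₁ > 0`, `J₂₂ < 0` (in particular `β < ζν`). -/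
theorem stmt13 (ζ β τ ν : ℝ) (hτ : 0 < τ) (hν : 1 < ν) (hβν : ν < β)
    (hζ : (β - 1) / (ν - 1) < ζ) :
    0 < Jmat ζ β τ ν 0 0 ∧ Jmat ζ β τ ν 0 1 < 0 ∧
    0 < Jmat ζ β τ ν 1 0 ∧ Jmat ζ β τ ν 1 1 < 0 ∧ β < ζ * ν := by
  have h1 : β - 1 < ζ * (ν - 1) := (div_lt_iff₀ (by linarith)).1 hζ
  have hz : 1 < ζ := by
    refine lt_trans ?_ hζ
    rw [lt_div_iff₀ (by linarith)]
    linarith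
  have hb : β < ζ * ν := by nlinarith
  have hd : 0 < ζ * (β - ν) := mul_pos (by linarith) (by linarith)
  have hz1 : 0 < ζ - 1 := by linarith
  have hβ : 0 < β := by linarith
  refine ⟨?_, ?_, ?_, ?_, hb⟩
  · exact div_pos (mul_pos hτ hz1) hd
  · exact div_neg_of_neg_of_pos (neg_neg_of_pos (mul_pos hβ hτ)) hd
  · exact div_pos (mul_pos hτ (pow_pos hz1 2)) hd
  · exact div_neg_of_neg_of_pos (mul_neg_of_pos_of_neg hτ (by linarith)) hd
end
end

section
/- Turing instability threshold in the self-diffusion case: assume τ > 0, ν > 1, β > ν and ζ > (β−1)/(ν−1) (so that ζ > 1 and ζν > β). Then, for a real number δ, the two Turing conditions δ(1−ζ) + ζν − β < 0 and δ²(ζ−1)² − 2δ(ζ−1)(β(2ζ−1) − ζν) + (β − ζν)² > 0 hold simultaneously if and only if δ > ( β(2ζ−1) − ζν + 2√(β ζ (β−ν)(ζ−1)) ) / (ζ−1), which equals (2βζ − β − ζν)/(ζ−1) + 2√(β ζ (β−ν)/(ζ−1)). -/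
/-- Turing instability threshold in the self-diffusion case: under the stated parameter
conditions, the two Turing conditions hold simultaneously iff the diffusion ratio `δ`
exceeds the explicit threshold, which also admits the stated alternative form. -/
theorem stmt16 (ζ β τ ν δ : ℝ) (hτ : 0 < τ) (hν : 1 < ν) (hβν : ν < β)
    (hζ : (β - 1) / (ν - 1) < ζ) :
    ((δ * (1 - ζ) + ζ * ν - β < 0 ∧
        0 < δ ^ 2 * (ζ - 1) ^ 2 - 2 * δ * (ζ - 1) * (β * (2 * ζ - 1) - ζ * ν)
          + (β - ζ * ν) ^ 2) ↔
      (β * (2 * ζ - 1) - ζ * ν + 2 * Real.sqrt (β * ζ * (β - ν) * (ζ - 1))) / (ζ - 1) < δ) ∧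
    (β * (2 * ζ - 1) - ζ * ν + 2 * Real.sqrt (β * ζ * (β - ν) * (ζ - 1))) / (ζ - 1)
      = (2 * β * ζ - β - ζ * ν) / (ζ - 1) + 2 * Real.sqrt (β * ζ * (β - ν) / (ζ - 1)) := by
  have hν' : 0 < ν - 1 := by linarith
  have h1 : β - 1 < ζ * (ν - 1) := (div_lt_iff₀ hν').1 hζ
  have hz : 0 < ζ - 1 := by
    by_contra h
    nlinarith
  have hb : 0 < β - ν := by linarith
  have hβ : 0 < β := by linarith
  have hζ0 : 0 < ζ := by linarith
  have hC : 0 < ζ * ν - β := by nlinarith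
  constructor
  · have hA : 0 < β * ζ * (β - ν) * (ζ - 1) := by positivity
    have hS : 0 < Real.sqrt (β * ζ * (β - ν) * (ζ - 1)) := Real.sqrt_pos.2 hA
    have hS2 := Real.sq_sqrt hA.le
    generalize Real.sqrt (β * ζ * (β - ν) * (ζ - 1)) = S at hS hS2 ⊢
    obtain ⟨B, hB⟩ : ∃ B, B = β * (2 * ζ - 1) - ζ * ν := ⟨_, rfl⟩
    obtain ⟨C, hCd⟩ : ∃ C, C = ζ * ν - β := ⟨_, rfl⟩
    obtain ⟨x, hx⟩ : ∃ x, x = δ * (ζ - 1) := ⟨_, rfl⟩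
    have hBC : 0 < B - C := by
      have : 0 < 2 * (ζ * (β - ν)) := by positivity
      rw [hB, hCd]; linarith
    have e4 : (2 * S) ^ 2 = B ^ 2 - C ^ 2 := by
      rw [mul_pow, hS2, hB, hCd]; ring
    have hlt : B - C < 2 * S := by
      have hC' : 0 < C := by rw [hCd]; exact hC
      refine lt_of_pow_lt_pow_left₀ 2 (by positivity) ?_
      rw [e4]
      nlinarith [mul_pos hC' hBC]
    have e1 : δ * (1 - ζ) + ζ * ν - β = C - x := by rw [hCd, hx]; ring
    have e2 : δ ^ 2 * (ζ - 1) ^ 2 - 2 * δ * (ζ - 1) * (β * (2 * ζ - 1) - ζ * ν)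
          + (β - ζ * ν) ^ 2 = (x - B - 2 * S) * (x - B + 2 * S) := by
      have : (x - B - 2 * S) * (x - B + 2 * S) = (x - B) ^ 2 - (2 * S) ^ 2 := by ring
      rw [this, e4, hB, hCd, hx]; ring
    rw [div_lt_iff₀ hz, e1, e2, ← hB, ← hx]
    constructor
    · rintro ⟨ha, hb⟩
      have : 0 < x - B + 2 * S := by linarith
      have := pos_of_mul_pos_left hb this.le
      linarith
    · intro h
      exact ⟨by linarith, mul_pos (by linarith) (by linarith)⟩
  · have e : β * ζ * (β - ν) * (ζ - 1) = β * ζ * (β - ν) / (ζ - 1) * (ζ - 1) ^ 2 := by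
      field_simp
    rw [e, Real.sqrt_mul (by positivity), Real.sqrt_sq hz.le]
    field_simp
end

section
/- Eventual Turing instability under cross-diffusion: fix real numbers β, ν, δ₁₂, δ₂₁ and assume ζ > 1. Define s₁(δ) = −β(δ₂₁ + 1) + δ₁₂(ζ−1)² − δζ + δ + ζν and s₂(δ) = ( δ₁₂(ζ−1)² − δζ − β(δ₂₁+1) + δ + ζν )² + 4(ζ−1)ζ(β−ν)(δ₁₂ δ₂₁ − δ). Then there exists δ̄ ∈ ℝ such that for every δ > δ̄ one has s₁(δ) < 0 and s₂(δ) > 0; that is, the cross-diffusion Turing conditions are satisfied for all sufficiently large diffusion ratio δ. -/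
/-- Eventual Turing instability under cross-diffusion: for `ζ > 1` there exists a
threshold `δ̄` such that for every diffusion ratio `δ > δ̄` the cross-diffusion Turing
conditions `s₁(δ) < 0` and `s₂(δ) > 0` are satisfied. -/
theorem stmt17 (ζ β ν δ₁₂ δ₂₁ : ℝ) (hζ : 1 < ζ) :
    ∃ δbar : ℝ, ∀ δ : ℝ, δbar < δ →
      (-β * (δ₂₁ + 1) + δ₁₂ * (ζ - 1) ^ 2 - δ * ζ + δ + ζ * ν < 0) ∧
      (0 < (δ₁₂ * (ζ - 1) ^ 2 - δ * ζ - β * (δ₂₁ + 1) + δ + ζ * ν) ^ 2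
          + 4 * (ζ - 1) * ζ * (β - ν) * (δ₁₂ * δ₂₁ - δ)) := by
  have ha : 0 < ζ - 1 := by linarith
  obtain ⟨C, hC⟩ : ∃ C, C = δ₁₂ * (ζ - 1) ^ 2 - β * (δ₂₁ + 1) + ζ * ν := ⟨_, rfl⟩
  obtain ⟨K, hK⟩ : ∃ K, K = 4 * ζ * (β - ν) := ⟨_, rfl⟩
  obtain ⟨M, hM⟩ : ∃ M, M = (ζ - 1) * K * (δ₁₂ * δ₂₁) - K * C := ⟨_, rfl⟩
  refine ⟨(C + |K| + |M| + 1) / (ζ - 1), fun δ hδ => ?_⟩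
  rw [div_lt_iff₀ ha] at hδ
  obtain ⟨y, hy⟩ : ∃ y, y = δ * (ζ - 1) - C := ⟨_, rfl⟩
  have hy1 : |K| + |M| + 1 < y := by linarith
  have hK0 := abs_nonneg K
  have hM0 := abs_nonneg M
  have hK1 := le_abs_self K
  have hM1 := neg_abs_le M
  constructor
  · have : -β * (δ₂₁ + 1) + δ₁₂ * (ζ - 1) ^ 2 - δ * ζ + δ + ζ * ν = -y := by
      rw [hy, hC]; ring
    rw [this]; linarith
  · have : (δ₁₂ * (ζ - 1) ^ 2 - δ * ζ - β * (δ₂₁ + 1) + δ + ζ * ν) ^ 2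
          + 4 * (ζ - 1) * ζ * (β - ν) * (δ₁₂ * δ₂₁ - δ) = y * (y - K) + M := by
      rw [hM, hy, hK, hC]; ring
    rw [this]
    have h : 1 * (|M| + 1) ≤ y * (y - K) :=
      mul_le_mul (by linarith) (by linarith) (by linarith) (by linarith)
    linarith
end
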